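/- arXiv:0812.2546 — 9 statements merged into one kernel-verified Lean document; each statement's English description precedes it below -/
import Mathlib

section
/- Chen–Stein bound under monotone coupling: Let I_1, …, I_n be {0,1}-valued random variables on a probability space with P(I_i = 1) > 0 for each i, and let W = I_1 + ⋯ + I_n with E(W) > 0. Suppose the I_i are negatively related, i.e. for each i there exist random variables U_i and V_i on the same probability space such that U_i has the same distribution as W, 1 + V_i has the same distribution as W conditioned on the event {I_i = 1}, and V_i ≤ U_i almost surely. Then ‖P(W ∈ ·) − P(Q_{E(W)} ∈ ·)‖_tv ≤ 1 − Var(W)/E(W). -/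
open MeasureTheory ProbabilityTheory Real Filter

/-- The Poisson probability mass function. -/
noncomputable def poissonWeight (l : ℝ) (k : ℕ) : ℝ := l ^ k * Real.exp (-l) / k.factorial

lemma poissonWeight_pos {l : ℝ} (hl : 0 < l) (k : ℕ) : 0 < poissonWeight l k := by
  unfold poissonWeight; positivity

lemma poissonWeight_succ (l : ℝ) (k : ℕ) :
    ((k + 1 : ℕ) : ℝ) * poissonWeight l (k + 1) = l * poissonWeight l k := by
  unfold poissonWeight
  rw [Nat.factorial_succ]
  push_cast
  field_simp
  ring

lemma hasSum_poissonWeight {l : ℝ} (hl : 0 < l) : HasSum (poissonWeight l) 1 := by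
  have h := hasSum_one_poissonMeasure ⟨l, hl.le⟩
  refine h.congr_fun fun k => ?_
  change l ^ k * Real.exp (-l) / k.factorial = Real.exp (-l) * l ^ k / k.factorial
  ring

lemma mul_sum_range_poissonWeight_le {l : ℝ} (hl : 0 < l) (k : ℕ) :
    l * ∑ j ∈ Finset.range k, poissonWeight l j ≤
      k * ∑ j ∈ Finset.range (k + 1), poissonWeight l j := by
  rw [Finset.sum_range_succ', mul_add, Finset.mul_sum, Finset.mul_sum]
  have h : ∑ j ∈ Finset.range k, l * poissonWeight l j ≤
      ∑ j ∈ Finset.range k, (k : ℝ) * poissonWeight l (j + 1) := by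
    refine Finset.sum_le_sum fun j hj => ?_
    rw [← poissonWeight_succ]
    refine mul_le_mul_of_nonneg_right ?_ (poissonWeight_pos hl _).le
    exact_mod_cast Finset.mem_range.mp hj
  have := poissonWeight_pos hl 0
  have : 0 ≤ (k : ℝ) * poissonWeight l 0 := by positivity
  linarith

lemma mul_one_sub_sum_range_poissonWeight_le {l : ℝ} (hl : 0 < l) (k : ℕ) :
    k * (1 - ∑ j ∈ Finset.range (k + 1), poissonWeight l j) ≤
      l * (1 - ∑ j ∈ Finset.range k, poissonWeight l j) := by
  have h := hasSum_poissonWeight hl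
  have h1 := ((hasSum_nat_add_iff' (k + 1)).mpr h).mul_left (k : ℝ)
  have h2 := ((hasSum_nat_add_iff' k).mpr h).mul_left l
  refine hasSum_le (fun j => ?_) h1 h2
  rw [← poissonWeight_succ, ← add_assoc]
  refine mul_le_mul_of_nonneg_right ?_ (poissonWeight_pos hl _).le
  push_cast
  linarith [(Nat.cast_nonneg j : (0 : ℝ) ≤ j)]

/-- The algebraic core of the Stein factor bound: the two capital variables are consecutive values of
the Poisson distribution function, and `a`, `b`, `c` are the masses of the parts of a set below,
at, and above the current point. -/
lemma abs_stein_increment_le {l m F F' p a b c : ℝ} (hl : 0 ≤ l) (hm : 0 ≤ m)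
    (hF : F = F' + p) (ha : 0 ≤ a) (haF : a ≤ F') (hb : 0 ≤ b) (hbp : b ≤ p) (hc : 0 ≤ c)
    (hcF : c ≤ 1 - F) (htail : m * (1 - F) ≤ l * (1 - F')) (hhead : l * F' ≤ m * F) :
    |m * (a + b - (a + b + c) * F) - l * (a - (a + b + c) * F')| ≤ m * p := by
  have hE : m * (a + b - (a + b + c) * F) - l * (a - (a + b + c) * F') =
      -(a * (l * (1 - F') - m * (1 - F))) + (b * m - b * (m * F - l * F'))
        - c * (m * F - l * F') := by ring
  have hT : F' * (l * (1 - F') - m * (1 - F)) + (1 - F) * (m * F - l * F') =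
      p * m - p * (m * F - l * F') := by subst hF; ring
  have hp : 0 ≤ p := hb.trans hbp
  have ht : 0 ≤ l * (1 - F') - m * (1 - F) := by linarith
  have hh : 0 ≤ m * F - l * F' := by linarith
  have hcoef : 0 ≤ m - (m * F - l * F') := by
    linarith [mul_nonneg hl (ha.trans haF), mul_nonneg hm (hc.trans hcF)]
  rw [hE, abs_le]
  constructor
  · nlinarith [mul_le_mul_of_nonneg_right haF ht, mul_le_mul_of_nonneg_right hcF hh,
      mul_nonneg hb hcoef, mul_nonneg hp hh]
  · nlinarith [mul_nonneg ha ht, mul_nonneg hc hh, mul_nonneg hb hh,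
      mul_le_mul_of_nonneg_right hbp hm]

/-- Solution of the Stein equation of the Poisson distribution for a set `A`,
with its smoothness bound. -/
lemma exists_stein_solution {l : ℝ} (hl : 0 < l) (A : Set ℕ) :
    ∃ g : ℕ → ℝ,
      (∀ k, l * g (k + 1) - k * g k =
        A.indicator 1 k - ∑' j, A.indicator (poissonWeight l) j) ∧
      ∀ k, |g (k + 2) - g (k + 1)| ≤ 1 / l := by
  set w := A.indicator (poissonWeight l) with hw
  set S := ∑' j, w j with hS
  have hsum := hasSum_poissonWeight hl
  have hw0 : ∀ k, 0 ≤ w k :=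
    fun k => Set.indicator_nonneg (fun j _ => (poissonWeight_pos hl j).le) k
  have hw1 : ∀ k, w k ≤ poissonWeight l k :=
    fun k => Set.indicator_le_self' (fun j _ => (poissonWeight_pos hl j).le) k
  have hwsum : HasSum w S := (Summable.of_nonneg_of_le hw0 hw1 hsum.summable).hasSum
  have hwA : ∀ k, w k = A.indicator 1 k * poissonWeight l k := fun k => by
    by_cases hk : k ∈ A <;> simp [hw, hk]
  let D : ℕ → ℝ := fun k =>
    ∑ j ∈ Finset.range k, w j - S * ∑ j ∈ Finset.range k, poissonWeight l j
  have hD : ∀ k, D (k + 1) = D k + (A.indicator 1 k - S) * poissonWeight l k := fun k => by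
    simp only [D, Finset.sum_range_succ, hwA k]; ring
  let g : ℕ → ℝ := fun k => D k / (k * poissonWeight l k)
  have hg : ∀ k, l * poissonWeight l k * g (k + 1) = D (k + 1) := fun k => by
    have := poissonWeight_pos hl k
    simp only [g]
    rw [poissonWeight_succ]
    field_simp
  have hg' : ∀ k, k * poissonWeight l k * g k = D k := fun k => by
    rcases k with _ | k
    · simp [D]
    · rw [poissonWeight_succ, hg]
  refine ⟨g, fun k => ?_, fun n => ?_⟩
  · have hp := poissonWeight_pos hl k
    refine mul_left_cancel₀ hp.ne' ?_
    linear_combination hg k - hg' k + hD k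
  · set k := n + 1 with hk
    have hp := poissonWeight_pos hl k
    have hk0 : (0 : ℝ) < k := by rw [hk]; positivity
    have h1 := hg k
    have h2 := hg' k
    have htail := (hasSum_nat_add_iff' (k + 1)).mpr hwsum
    have htail1 := (hasSum_nat_add_iff' (k + 1)).mpr hsum
    have key := abs_stein_increment_le (l := l) (m := k)
      (F := ∑ j ∈ Finset.range (k + 1), poissonWeight l j)
      (F' := ∑ j ∈ Finset.range k, poissonWeight l j)
      (p := poissonWeight l k) (a := ∑ j ∈ Finset.range k, w j) (b := w k)
      (c := S - ∑ j ∈ Finset.range (k + 1), w j) hl.le hk0.le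
      (Finset.sum_range_succ _ _)
      (Finset.sum_nonneg fun j _ => hw0 j) (Finset.sum_le_sum fun j _ => hw1 j) (hw0 k) (hw1 k)
      (htail.nonneg fun j => hw0 _) (hasSum_le (fun j => hw1 _) htail htail1)
      (mul_one_sub_sum_range_poissonWeight_le hl k) (mul_sum_range_poissonWeight_le hl k)
    rw [← Finset.sum_range_succ, add_sub_cancel] at key
    change |(k : ℝ) * D (k + 1) - l * D k| ≤ _ at key
    rw [← h1, ← h2, show (k : ℝ) * (l * poissonWeight l k * g (k + 1)) -
      l * (k * poissonWeight l k * g k) = (k * poissonWeight l k) * (l * (g (k + 1) - g k)) by ring,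
      abs_mul, abs_of_pos (by positivity : 0 < (k : ℝ) * poissonWeight l k), abs_mul,
      abs_of_pos hl] at key
    rw [le_div_iff₀ hl, mul_comm]
    exact le_of_mul_le_mul_left (by linarith) (by positivity : 0 < (k : ℝ) * poissonWeight l k)

lemma abs_sub_le_of_abs_succ_sub_le {f : ℕ → ℝ} {C : ℝ} (hf : ∀ k, |f (k + 1) - f k| ≤ C)
    {m n : ℕ} (hmn : m ≤ n) : |f n - f m| ≤ C * (n - m) := by
  induction n, hmn using Nat.le_induction with
  | base => simp
  | succ n _ ih =>
    have := abs_add_le (f (n + 1) - f n) (f n - f m)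
    rw [sub_add_sub_cancel] at this
    push_cast
    linarith [hf n]

lemma integrable_comp_of_le {Ω : Type*} [MeasurableSpace Ω] {P : Measure Ω} [IsFiniteMeasure P]
    {W : Ω → ℕ} (hW : Measurable W) {n : ℕ} (hn : ∀ ω, W ω ≤ n) (f : ℕ → ℝ) :
    Integrable (fun ω => f (W ω)) P := by
  refine Integrable.of_bound ((measurable_of_countable f).comp hW).aestronglyMeasurable
    (∑ k ∈ Finset.range (n + 1), |f k|) (.of_forall fun ω => ?_)
  exact Finset.single_le_sum (f := fun k => |f k|) (fun _ _ => abs_nonneg _)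
    (Finset.mem_range.mpr (Nat.lt_succ_of_le (hn ω)))

lemma integrable_comp_of_map_eq {Ω : Type*} [MeasurableSpace Ω] {P Q : Measure Ω}
    {W X : Ω → ℕ} (hW : Measurable W) (hX : Measurable X)
    (h : Measure.map X P = Measure.map W Q) (f : ℕ → ℝ) (hf : Integrable (fun ω => f (W ω)) Q) :
    Integrable (fun ω => f (X ω)) P := by
  have hfm : ∀ μ : Measure ℕ, AEStronglyMeasurable f μ :=
    fun μ => (measurable_of_countable f).aestronglyMeasurable
  refine (integrable_map_measure (hfm _) hX.aemeasurable).mp ?_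
  rw [h]
  exact (integrable_map_measure (hfm _) hW.aemeasurable).mpr hf

lemma integral_comp_of_map_eq {Ω : Type*} [MeasurableSpace Ω] {P Q : Measure Ω}
    {W X : Ω → ℕ} (hW : Measurable W) (hX : Measurable X)
    (h : Measure.map X P = Measure.map W Q) (f : ℕ → ℝ) :
    ∫ ω, f (X ω) ∂P = ∫ ω, f (W ω) ∂Q := by
  have hfm : ∀ μ : Measure ℕ, AEStronglyMeasurable f μ :=
    fun μ => (measurable_of_countable f).aestronglyMeasurable
  rw [← integral_map hX.aemeasurable (hfm _), h, integral_map hW.aemeasurable (hfm _)]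

lemma integral_mul_integral_cond {Ω : Type*} [MeasurableSpace Ω] {P : Measure Ω}
    [IsProbabilityMeasure P] {J : Ω → ℕ} (hJ : Measurable J) (hJ1 : ∀ ω, J ω ≤ 1)
    (hpos : 0 < P {ω | J ω = 1}) (F : Ω → ℝ) :
    (∫ ω, (J ω : ℝ) ∂P) * ∫ ω, F ω ∂(P[|{ω | J ω = 1}]) = ∫ ω, J ω * F ω ∂P := by
  have hs : MeasurableSet {ω | J ω = 1} := hJ (measurableSet_singleton 1)
  have hind : ∀ G : Ω → ℝ, ∫ ω, (J ω : ℝ) * G ω ∂P = ∫ ω in {ω | J ω = 1}, G ω ∂P := fun G => by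
    rw [← integral_indicator hs]
    refine integral_congr_ae (.of_forall fun ω => ?_)
    rcases Nat.le_one_iff_eq_zero_or_eq_one.mp (hJ1 ω) with h | h <;> simp [Set.indicator, h]
  have h1 : ∫ ω, (J ω : ℝ) ∂P = P.real {ω | J ω = 1} := by
    simpa using hind 1
  have hne : P.real {ω | J ω = 1} ≠ 0 :=
    (ENNReal.toReal_pos hpos.ne' (measure_ne_top _ _)).ne'
  rw [h1, hind, ProbabilityTheory.cond, integral_smul_measure, ENNReal.toReal_inv, smul_eq_mul,
    ← mul_assoc, ← measureReal_def, mul_inv_cancel₀ hne, one_mul]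

open MeasureTheory ProbabilityTheory Real Filter
/-- **Chen–Stein bound under monotone coupling.** If `W = I₁ + ⋯ + Iₙ` is a sum of
Bernoulli random variables that are negatively related (monotone coupling condition),
then the total variation distance between the law of `W` and the Poisson distribution
with mean `E(W)` is at most `1 - Var(W)/E(W)`. -/
theorem chen_stein_negatively_related
    {Ω : Type*} [MeasurableSpace Ω] (P : Measure Ω) [IsProbabilityMeasure P]
    (n : ℕ) (I : Fin n → Ω → ℕ)
    (hmeas : ∀ i, Measurable (I i))
    (hBernoulli : ∀ i ω, I i ω ≤ 1)
    (hpos : ∀ i, 0 < P {ω | I i ω = 1})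
    (W : Ω → ℕ) (hW : ∀ ω, W ω = ∑ i, I i ω)
    (hWmeas : Measurable W)
    (hmean : 0 < ∫ ω, (W ω : ℝ) ∂P)
    (hneg : ∀ i, ∃ U V : Ω → ℕ, Measurable U ∧ Measurable V ∧
      Measure.map U P = Measure.map W P ∧
      Measure.map (fun ω => 1 + V ω) P = Measure.map W (P[|{ω | I i ω = 1}]) ∧
      ∀ᵐ ω ∂P, V ω ≤ U ω) :
    ∀ A : Set ℕ,
      |(P {ω | W ω ∈ A}).toReal -
          ∑' k : ℕ, A.indicator
            (fun k => (∫ ω, (W ω : ℝ) ∂P) ^ k * Real.exp (-∫ ω, (W ω : ℝ) ∂P) /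
              k.factorial) k|
        ≤ 1 - variance (fun ω => (W ω : ℝ)) P / ∫ ω, (W ω : ℝ) ∂P := by
  intro A
  have hWn : ∀ ω, W ω ≤ n := fun ω => by
    rw [hW]
    simpa using Finset.sum_le_sum fun i (_ : i ∈ Finset.univ) => hBernoulli i ω
  have hI : ∀ f : ℕ → ℝ, Integrable (fun ω => f (W ω)) P :=
    fun f => integrable_comp_of_le hWmeas hWn f
  have hII : ∀ i (f : ℕ → ℝ), Integrable (fun ω => (I i ω : ℝ) * f (W ω)) P := fun i f =>
    (hI f).bdd_mul (c := 1) ((measurable_of_countable _).comp (hmeas i)).aestronglyMeasurable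
      (.of_forall fun ω => by simpa using hBernoulli i ω)
  have hIi : ∀ i, Integrable (fun ω => (I i ω : ℝ)) P := fun i => by simpa using hII i 1
  have hsumI : ∀ f : ℕ → ℝ, ∑ i, ∫ ω, (I i ω : ℝ) * f (W ω) ∂P = ∫ ω, W ω * f (W ω) ∂P := by
    intro f
    rw [← integral_finsetSum _ fun i _ => hII i f]
    refine integral_congr_ae (.of_forall fun ω => ?_)
    simp only [← Finset.sum_mul]
    congr 1
    rw [hW]
    push_cast
    rfl
  set l := ∫ ω, (W ω : ℝ) ∂P with hl
  have hsum1 : ∑ i, ∫ ω, (I i ω : ℝ) ∂P = l := by simpa using hsumI 1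
  have hvar : variance (fun ω => (W ω : ℝ)) P = ∫ ω, (W ω : ℝ) * W ω ∂P - l ^ 2 := by
    rw [variance_eq_sub ((memLp_two_iff_integrable_sq (hI _).aestronglyMeasurable).mpr
      (hI fun k => (k : ℝ) ^ 2))]
    simp [hl, pow_two]
  obtain ⟨g, hg, hgb⟩ := exists_stein_solution hmean A
  have hterm : ∀ i, |(∫ ω, (I i ω : ℝ) ∂P) * ∫ ω, g (W ω + 1) ∂P - ∫ ω, I i ω * g (W ω) ∂P| ≤
      1 / l * ((∫ ω, (I i ω : ℝ) ∂P) * (l + 1) - ∫ ω, (I i ω : ℝ) * W ω ∂P) := by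
    intro i
    obtain ⟨U, V, hU, hV, hUW, hVW, hVU⟩ := hneg i
    have := cond_isProbabilityMeasure (hpos i).ne'
    have hV' : Measurable fun ω => 1 + V ω := (measurable_of_countable _).comp hV
    have hIU : ∀ f : ℕ → ℝ, Integrable (fun ω => f (U ω)) P := fun f =>
      integrable_comp_of_map_eq hWmeas hU hUW f (hI f)
    have hIV : ∀ f : ℕ → ℝ, Integrable (fun ω => f (1 + V ω)) P := fun f =>
      integrable_comp_of_map_eq hWmeas hV' hVW f (integrable_comp_of_le hWmeas hWn f)
    have hcond : ∀ f : ℕ → ℝ,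
        (∫ ω, (I i ω : ℝ) ∂P) * ∫ ω, f (1 + V ω) ∂P = ∫ ω, I i ω * f (W ω) ∂P := fun f => by
      rw [integral_comp_of_map_eq hWmeas hV' hVW f]
      exact integral_mul_integral_cond (hmeas i) (hBernoulli i) (hpos i) _
    have hdiff : |∫ ω, g (U ω + 1) ∂P - ∫ ω, g (1 + V ω) ∂P| ≤
        1 / l * (∫ ω, (U ω + 1 : ℝ) ∂P - ∫ ω, ((1 + V ω : ℕ) : ℝ) ∂P) := by
      rw [← integral_sub (hIU fun k => g (k + 1)) (hIV g),
        ← integral_sub (hIU fun k => (k + 1 : ℝ)) (hIV fun k => (k : ℝ)), ← integral_const_mul]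
      refine (abs_integral_le_integral_abs).trans (integral_mono_ae
        ((hIU fun k => g (k + 1)).sub (hIV g)).abs
        (((hIU fun k => (k + 1 : ℝ)).sub (hIV fun k => (k : ℝ))).const_mul _) ?_)
      filter_upwards [hVU] with ω hω
      have h := abs_sub_le_of_abs_succ_sub_le (f := fun k => g (k + 1)) hgb hω
      simp only [add_comm 1 (V ω)]
      push_cast
      rwa [add_sub_add_right_eq_sub]
    have hp : 0 ≤ ∫ ω, (I i ω : ℝ) ∂P := integral_nonneg fun ω => by positivity
    have hEU : ∫ ω, (U ω + 1 : ℝ) ∂P = l + 1 := by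
      rw [integral_comp_of_map_eq hWmeas hU hUW fun k => (k + 1 : ℝ),
        integral_add (hI fun k => (k : ℝ)) (integrable_const _)]
      simp [hl]
    rw [integral_comp_of_map_eq hWmeas hU hUW fun k => g (k + 1), hEU] at hdiff
    rw [← hcond g, ← hcond fun k => (k : ℝ), ← mul_sub, ← mul_sub, abs_mul, abs_of_nonneg hp,
      mul_left_comm]
    exact mul_le_mul_of_nonneg_left hdiff hp
  have hstein : (P {ω | W ω ∈ A}).toReal - ∑' k, A.indicator (poissonWeight l) k =
      ∑ i, ((∫ ω, (I i ω : ℝ) ∂P) * ∫ ω, g (W ω + 1) ∂P - ∫ ω, I i ω * g (W ω) ∂P) := by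
    have hA : ∫ ω, A.indicator (1 : ℕ → ℝ) (W ω) ∂P = (P {ω | W ω ∈ A}).toReal := by
      have := integral_indicator_one (μ := P) (hWmeas (MeasurableSet.of_discrete (s := A)))
      rw [measureReal_def] at this
      exact this
    rw [Finset.sum_sub_distrib, ← Finset.sum_mul, hsum1, hsumI, ← integral_const_mul,
      ← integral_sub (hI fun k => l * g (k + 1)) (hI fun k => k * g k)]
    simp only [hg]
    rw [integral_sub (hI fun k => A.indicator 1 k) (integrable_const _), hA]
    simp
  change |(P {ω | W ω ∈ A}).toReal - ∑' k, A.indicator (poissonWeight l) k| ≤ _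
  rw [hstein]
  refine (Finset.abs_sum_le_sum_abs _ _).trans ((Finset.sum_le_sum fun i _ => hterm i).trans
    (le_of_eq ?_))
  rw [← Finset.mul_sum, Finset.sum_sub_distrib, ← Finset.sum_mul, hsum1,
    hsumI fun k => (k : ℝ), hvar]
  field_simp
  ring
end

section
/- For every integer n ≥ 1 and every q ∈ [0,1], the total variation distance between the binomial distribution with parameters n and q and the Poisson distribution with mean nq satisfies ‖Binomial(n,q) − Poisson(nq)‖_tv ≤ min(n q², q). -/
open MeasureTheory Real

section SteinEquation

variable {p f : ℕ → ℝ} {r : ℝ}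

/-- The solution of the Stein equation `r * g (k + 1) - k * g k = f k - ∑' j, f j * p j` of a
Poisson mass function `p` of mean `r`. -/
noncomputable def steinSolution (p f : ℕ → ℝ) (k : ℕ) : ℝ :=
  (∑ j ∈ Finset.range k, (f j - ∑' i, f i * p i) * p j) / (k * p k)

lemma steinSolution_equation (hp : ∀ k, 0 < p k) (hr : 0 < r)
    (hrec : ∀ k : ℕ, (k + 1) * p (k + 1) = r * p k) (k : ℕ) :
    r * steinSolution p f (k + 1) - k * steinSolution p f k = f k - ∑' i, f i * p i := by
  have hpk := (hp k).ne'
  unfold steinSolution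
  rw [Nat.cast_add_one, hrec, Finset.sum_range_succ]
  rcases Nat.eq_zero_or_pos k with rfl | hk
  · simp only [Finset.range_zero, Finset.sum_empty, Nat.cast_zero]
    field_simp
    ring
  · have hk' : (k : ℝ) ≠ 0 := by positivity
    field_simp
    ring

lemma mul_sum_range_le (hp : ∀ k, 0 < p k)
    (hrec : ∀ k : ℕ, (k + 1) * p (k + 1) = r * p k) (k : ℕ) :
    r * ∑ j ∈ Finset.range k, p j ≤ k * (∑ j ∈ Finset.range (k + 1), p j - p 0) := by
  rw [Finset.sum_range_succ', add_sub_cancel_right, Finset.mul_sum, Finset.mul_sum]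
  refine Finset.sum_le_sum fun j hj => ?_
  rw [← hrec]
  have hjk : ((j + 1 : ℕ) : ℝ) ≤ k := by exact_mod_cast Finset.mem_range.1 hj
  push_cast at hjk
  exact mul_le_mul_of_nonneg_right hjk (hp _).le

lemma mul_one_sub_sum_range_le (hp : ∀ k, 0 < p k) (hsum : HasSum p 1)
    (hrec : ∀ k : ℕ, (k + 1) * p (k + 1) = r * p k) (k : ℕ) :
    k * (1 - ∑ j ∈ Finset.range (k + 1), p j) ≤ r * (1 - ∑ j ∈ Finset.range k, p j) := by
  have htail (m : ℕ) : HasSum (fun j => p (j + m)) (1 - ∑ j ∈ Finset.range m, p j) :=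
    (hasSum_nat_add_iff' m).2 hsum
  refine hasSum_le (fun j => ?_) ((htail (k + 1)).mul_left (k : ℝ)) ((htail k).mul_left r)
  rw [← hrec, ← add_assoc]
  refine mul_le_mul_of_nonneg_right ?_ (hp _).le
  push_cast
  linarith [(Nat.cast_nonneg j : (0 : ℝ) ≤ j)]

lemma steinSolution_succ_sub_le (hp : ∀ k, 0 < p k) (hsum : HasSum p 1) (hr : 0 < r)
    (hrec : ∀ k : ℕ, (k + 1) * p (k + 1) = r * p k) (hf0 : ∀ k, 0 ≤ f k) (hf1 : ∀ k, f k ≤ 1)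
    {k : ℕ} (hk : 0 < k) :
    steinSolution p f (k + 1) - steinSolution p f k ≤ (1 - p 0) / r := by
  have hk' : (0 : ℝ) < k := by exact_mod_cast hk
  have hpk := hp k
  have hfp (j : ℕ) : 0 ≤ f j * p j := mul_nonneg (hf0 j) (hp j).le
  have hsummable : Summable fun j => f j * p j :=
    .of_nonneg_of_le hfp (fun j => mul_le_of_le_one_left (hp j).le (hf1 j)) hsum.summable
  have hhead : 0 ≤ ∑ j ∈ Finset.range k, f j * p j := Finset.sum_nonneg fun j _ => hfp j
  have htail : ∑ j ∈ Finset.range k, f j * p j + f k * p k ≤ ∑' i, f i * p i := by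
    rw [← Finset.sum_range_succ]
    exact hsummable.sum_le_tsum _ fun j _ => hfp j
  have hlow := mul_sum_range_le hp hrec k
  have hhigh := mul_one_sub_sum_range_le hp hsum hrec k
  have hnonneg : 0 ≤ ∑ j ∈ Finset.range k, p j := Finset.sum_nonneg fun j _ => (hp j).le
  have hle : ∑ j ∈ Finset.range (k + 1), p j ≤ 1 := sum_le_hasSum _ (fun j _ => (hp j).le) hsum
  have hp0 := hp 0
  have hfk := hf1 k
  unfold steinSolution
  rw [Nat.cast_add_one, hrec, Finset.sum_range_succ]
  simp only [sub_mul, Finset.sum_sub_distrib, ← Finset.mul_sum]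
  rw [Finset.sum_range_succ] at hlow hhigh hle
  generalize ∑ j ∈ Finset.range k, p j = F at *
  generalize ∑ j ∈ Finset.range k, f j * p j = a at *
  generalize ∑' i, f i * p i = s at *
  rw [div_sub_div _ _ (by positivity) (by positivity), div_le_div_iff₀ (by positivity) hr]
  have hcoef : 0 ≤ k * (1 - (F + p k)) + r * F :=
    add_nonneg (mul_nonneg hk'.le (by linarith)) (mul_nonneg hr.le hnonneg)
  have hmain : k * (a - s * F + (f k * p k - s * p k)) - r * (a - s * F) ≤ k * p k * (1 - p 0) := by
    nlinarith [mul_nonneg hhead (sub_nonneg.2 hhigh),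
      mul_nonneg (sub_nonneg.2 htail) (sub_nonneg.2 hlow),
      mul_nonneg (sub_nonneg.2 htail) (mul_nonneg hk'.le hp0.le),
      mul_nonneg (mul_nonneg (sub_nonneg.2 hfk) hpk.le) hcoef,
      mul_nonneg hpk.le (sub_nonneg.2 hlow)]
  calc _ = p k * r * (k * (a - s * F + (f k * p k - s * p k)) - r * (a - s * F)) := by ring
    _ ≤ p k * r * (k * p k * (1 - p 0)) := by gcongr
    _ = _ := by ring

end SteinEquation

section BinomialMean

/-- The mean of `f` under the binomial distribution with parameters `n` and `q`. -/
noncomputable def binomialMean (n : ℕ) (q : ℝ) (f : ℕ → ℝ) : ℝ :=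
  ∑ k ∈ Finset.range (n + 1), n.choose k * q ^ k * (1 - q) ^ (n - k) * f k

variable (n : ℕ) (q : ℝ) (f g : ℕ → ℝ)

lemma binomialMean_sub :
    binomialMean n q (fun k => f k - g k) = binomialMean n q f - binomialMean n q g := by
  simp [binomialMean, mul_sub]

lemma binomialMean_const_mul (c : ℝ) :
    binomialMean n q (fun k => c * f k) = c * binomialMean n q f := by
  simp only [binomialMean, Finset.mul_sum]
  exact Finset.sum_congr rfl fun k _ => by ring

lemma binomialMean_const (c : ℝ) : binomialMean n q (fun _ => c) = c := by
  have h := add_pow q (1 - q) n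
  rw [add_sub_cancel, one_pow] at h
  rw [binomialMean, ← Finset.sum_mul]
  conv_rhs => rw [← one_mul c, h]
  exact congrArg (· * c) (Finset.sum_congr rfl fun k _ => by ring)

variable {n q f g} in
lemma binomialMean_mono (hq : q ∈ Set.Icc (0 : ℝ) 1) (h : ∀ k, f k ≤ g k) :
    binomialMean n q f ≤ binomialMean n q g := by
  have h0 := hq.1
  have h1 := sub_nonneg.2 hq.2
  exact Finset.sum_le_sum fun k _ => mul_le_mul_of_nonneg_left (h k) (by positivity)

lemma binomialMean_succ :
    binomialMean (n + 1) q f =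
      (1 - q) * binomialMean n q f + q * binomialMean n q (fun k => f (k + 1)) := by
  have hanti (m : ℕ) (u : ℕ → ℝ) : binomialMean m q u =
      ∑ ij ∈ Finset.HasAntidiagonal.antidiagonal m, m.choose ij.1 * (q ^ ij.1 * (1 - q) ^ ij.2 * u ij.1) := by
    rw [Finset.Nat.sum_antidiagonal_eq_sum_range_succ
      (fun i j => (m.choose i : ℝ) * (q ^ i * (1 - q) ^ j * u i)), binomialMean]
    exact Finset.sum_congr rfl fun k _ => by ring
  rw [hanti, hanti, hanti,
    Finset.sum_antidiagonal_choose_succ_mul (fun i j => q ^ i * (1 - q) ^ j * f i),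
    Finset.mul_sum, Finset.mul_sum]
  refine congrArg₂ _ (Finset.sum_congr rfl fun ij _ => by ring)
    (Finset.sum_congr rfl fun ij hij => ?_)
  rw [Nat.choose_symm_of_eq_add (Finset.HasAntidiagonal.mem_antidiagonal.1 hij).symm]
  ring

lemma binomialMean_succ_id_mul :
    binomialMean (n + 1) q (fun k => k * f k) =
      (n + 1) * q * binomialMean n q (fun k => f (k + 1)) := by
  rw [binomialMean, Finset.sum_range_succ', binomialMean, Finset.mul_sum]
  simp only [Nat.cast_zero, zero_mul, mul_zero, add_zero]
  refine Finset.sum_congr rfl fun k _ => ?_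
  have h : ((n : ℝ) + 1) * n.choose k = (n + 1).choose (k + 1) * (k + 1) := by
    exact_mod_cast Nat.add_one_mul_choose_eq n k
  rw [Nat.add_sub_add_right]
  push_cast
  linear_combination -(q ^ (k + 1) * (1 - q) ^ (n - k) * f (k + 1)) * h

/-- Stein's identity for the binomial distribution. -/
lemma binomialMean_stein :
    binomialMean (n + 1) q (fun k => (n + 1) * q * g (k + 1) - k * g k) =
      (n + 1) * q * q * binomialMean n q (fun k => g (k + 2) - g (k + 1)) := by
  rw [binomialMean_sub, binomialMean_const_mul _ _ (fun k => g (k + 1)),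
    binomialMean_succ_id_mul, binomialMean_succ,
    binomialMean_sub n q (fun k => g (k + 2)) (fun k => g (k + 1))]
  ring

end BinomialMean

lemma hasSum_poisson (r : ℝ) : HasSum (fun k : ℕ => r ^ k * exp (-r) / k.factorial) 1 := by
  have h := (NormedSpace.expSeries_div_hasSum_exp r).mul_right (exp (-r))
  rw [← Real.exp_eq_exp_ℝ, ← Real.exp_add, add_neg_cancel, Real.exp_zero] at h
  simpa only [div_mul_eq_mul_div] using h

lemma binomialMean_sub_tsum_poisson_le {n : ℕ} {q : ℝ} (hn : 1 ≤ n) (hq : q ∈ Set.Icc (0 : ℝ) 1)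
    (hq0 : 0 < q) {f : ℕ → ℝ} (hf0 : ∀ k, 0 ≤ f k) (hf1 : ∀ k, f k ≤ 1) :
    binomialMean n q f - ∑' k, f k * ((n * q) ^ k * exp (-(n * q)) / k.factorial) ≤
      q * (1 - exp (-(n * q))) := by
  obtain ⟨m, rfl⟩ := Nat.exists_eq_add_of_le' hn
  set r : ℝ := (m + 1 : ℕ) * q with hr_def
  have hr : 0 < r := by positivity
  set p : ℕ → ℝ := fun k => r ^ k * exp (-r) / k.factorial with hp_def
  have hp (k : ℕ) : 0 < p k := by positivity
  have hsum : HasSum p 1 := hasSum_poisson r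
  have hrec (k : ℕ) : (k + 1) * p (k + 1) = r * p k := by
    simp only [hp_def, Nat.factorial_succ]
    push_cast
    field_simp
    ring
  have hp0 : p 0 = exp (-r) := by simp [hp_def]
  have hr' : ((m : ℝ) + 1) * q = r := by rw [hr_def, Nat.cast_add_one]
  have hstein := binomialMean_stein m q (steinSolution p f)
  simp only [hr', steinSolution_equation hp hr hrec] at hstein
  rw [binomialMean_sub, binomialMean_const] at hstein
  have hbound : binomialMean m q
      (fun k => steinSolution p f (k + 2) - steinSolution p f (k + 1)) ≤ (1 - p 0) / r := by
    rw [← binomialMean_const m q ((1 - p 0) / r)]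
    exact binomialMean_mono hq fun k =>
      steinSolution_succ_sub_le hp hsum hr hrec hf0 hf1 k.succ_pos
  calc _ = r * q * _ := hstein
    _ ≤ r * q * ((1 - p 0) / r) := by gcongr
    _ = q * (1 - exp (-r)) := by rw [hp0]; field_simp

/-- The total variation distance between the binomial distribution with parameters
`n ≥ 1` and `q ∈ [0,1]` and the Poisson distribution with mean `n q` is at most
`min (n q²) q`. -/
theorem binomial_poisson_tv_bound (n : ℕ) (hn : 1 ≤ n) (q : ℝ) (hq : q ∈ Set.Icc (0:ℝ) 1) :
    ∀ A : Set ℕ,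
      |(∑' k : ℕ, A.indicator
            (fun k => (n.choose k : ℝ) * q ^ k * (1 - q) ^ (n - k)) k) -
          ∑' k : ℕ, A.indicator
            (fun k => (n * q) ^ k * Real.exp (-(n * q)) / k.factorial) k|
        ≤ min (n * q ^ 2) q := by
  intro A
  rcases hq.1.eq_or_lt with rfl | hq0
  · have h : (fun k => (n.choose k : ℝ) * 0 ^ k * (1 - 0) ^ (n - k)) =
        fun k => (n * (0 : ℝ)) ^ k * Real.exp (-(n * 0)) / k.factorial := by
      funext k
      cases k <;> simp
    rw [h, sub_self, abs_zero]
    simp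
  have hbin : (∑' k : ℕ, A.indicator
      (fun k => (n.choose k : ℝ) * q ^ k * (1 - q) ^ (n - k)) k) =
        binomialMean n q (A.indicator 1) := by
    rw [tsum_eq_sum (s := Finset.range (n + 1))]
    · exact Finset.sum_congr rfl fun k _ => by by_cases hk : k ∈ A <;> simp [hk]
    · intro k hk
      have hnk : n < k := by simpa [Nat.lt_succ_iff] using hk
      simp [Nat.choose_eq_zero_of_lt hnk]
  have hpoi (B : Set ℕ) : (∑' k : ℕ, B.indicator
      (fun k => (n * q) ^ k * Real.exp (-(n * q)) / k.factorial) k) =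
        ∑' k, B.indicator (1 : ℕ → ℝ) k * ((n * q) ^ k * exp (-(n * q)) / k.factorial) :=
    tsum_congr fun k => by by_cases hk : k ∈ B <;> simp [hk]
  have hle (B : Set ℕ) := binomialMean_sub_tsum_poisson_le hn hq hq0
    (f := B.indicator 1) (fun k => Set.indicator_nonneg (fun _ _ => zero_le_one) k)
    (fun k => Set.indicator_le_self' (fun _ _ => zero_le_one) k)
  have hsum := hasSum_poisson (n * q)
  have hbin_compl : binomialMean n q (Aᶜ.indicator 1) = 1 - binomialMean n q (A.indicator 1) := by
    rw [← binomialMean_const n q 1, ← binomialMean_sub, Set.indicator_compl]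
    rfl
  have hpoi_compl := (hsum.summable.indicator A).tsum_add (hsum.summable.indicator Aᶜ)
  simp only [Set.indicator_self_add_compl_apply, hsum.tsum_eq, hpoi] at hpoi_compl
  have hcompl := hle Aᶜ
  have hA := hle A
  have hexp : 1 - exp (-(n * q)) ≤ n * q := by linarith [Real.add_one_le_exp (-(n * q))]
  have hmin : q * (1 - exp (-(n * q))) ≤ min (n * q ^ 2) q :=
    le_min (by nlinarith) (by nlinarith [Real.exp_pos (-(n * q))])
  rw [hbin, hpoi]
  refine (abs_le.2 ⟨?_, hA⟩).trans hmin
  linarith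
end

section
/- Exact form of Q_j for a Pareto distribution: Let v have the Pareto distribution with shape a > 1 and location b > 0, i.e. P(v > x) = (b/x)^a for x ≥ b. Then for every p > 0 and every integer j > a, E[(p v)^j e^{−p v}]/j! = (a b^a p^a / j!) ∫_{p b}^{∞} u^{j−a−1} e^{−u} du = a (p b)^a Γ(j−a)/j! − (a (p b)^j / j!) ∫_0^1 u^{j−a−1} e^{−p b u} du, where Γ is Euler's Gamma function. -/
open MeasureTheory Real

lemma paretoMeasure_real_Ioi {a b x : ℝ} (ha : 0 < a) (hb : 0 < b) (hx : b ≤ x) :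
    (ProbabilityTheory.paretoMeasure b a).real (Set.Ioi x) = (b / x) ^ a := by
  have hx0 : 0 < x := hb.trans_le hx
  have hint : IntegrableOn (fun y : ℝ ↦ a * b ^ a * y ^ (-(a + 1))) (Set.Ioi x) :=
    (integrableOn_Ioi_rpow_of_lt (by linarith) hx0).const_mul _
  have h : ProbabilityTheory.paretoMeasure b a (Set.Ioi x) =
      ENNReal.ofReal (∫ y in Set.Ioi x, a * b ^ a * y ^ (-(a + 1))) := by
    rw [ProbabilityTheory.paretoMeasure, withDensity_apply _ measurableSet_Ioi,
      ofReal_integral_eq_lintegral_ofReal hint]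
    · refine setLIntegral_congr_fun measurableSet_Ioi fun y hy ↦ ?_
      exact ProbabilityTheory.paretoPDF_of_le (hx.trans (le_of_lt hy))
    · filter_upwards [ae_restrict_mem measurableSet_Ioi] with y hy
      have : 0 < y := hx0.trans hy
      positivity
  have hval : ∫ y in Set.Ioi x, a * b ^ a * y ^ (-(a + 1)) = (b / x) ^ a := by
    rw [integral_const_mul, integral_Ioi_rpow_of_lt (by linarith) hx0,
      div_rpow hb.le hx0.le, show -(a + 1) + 1 = -a by ring, rpow_neg hx0.le]
    field_simp
  rw [Measure.real, h, hval, ENNReal.toReal_ofReal (by positivity)]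

/-- A probability measure on `ℝ` with Pareto tail is the Pareto measure. -/
lemma eq_paretoMeasure_of_real_Ioi {μ : Measure ℝ} [IsProbabilityMeasure μ] {a b : ℝ}
    (ha : 0 < a) (hb : 0 < b) (h : ∀ x, b ≤ x → μ.real (Set.Ioi x) = (b / x) ^ a) :
    μ = ProbabilityTheory.paretoMeasure b a := by
  have := ProbabilityTheory.isProbabilityMeasure_paretoMeasure hb ha
  have one_of_lt (ν : Measure ℝ) [IsProbabilityMeasure ν]
      (hν : ∀ x, b ≤ x → ν.real (Set.Ioi x) = (b / x) ^ a) (x : ℝ) (hx : x < b) :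
      ν.real (Set.Ioi x) = 1 := by
    refine le_antisymm measureReal_le_one ?_
    calc (1 : ℝ) = ν.real (Set.Ioi b) := by rw [hν b le_rfl, div_self hb.ne', one_rpow]
      _ ≤ ν.real (Set.Ioi x) := measureReal_mono (Set.Ioi_subset_Ioi hx.le)
  have hp : ∀ x, b ≤ x →
      (ProbabilityTheory.paretoMeasure b a).real (Set.Ioi x) = (b / x) ^ a :=
    fun x ↦ paretoMeasure_real_Ioi ha hb
  refine Measure.ext_of_Iic _ _ fun x ↦ ?_
  rw [← measureReal_eq_measureReal_iff, ← Set.compl_Ioi,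
    probReal_compl_eq_one_sub measurableSet_Ioi, probReal_compl_eq_one_sub measurableSet_Ioi]
  rcases le_or_gt b x with hx | hx
  · rw [h x hx, hp x hx]
  · rw [one_of_lt _ h x hx, one_of_lt _ hp x hx]

lemma integral_paretoMeasure {a b : ℝ} (ha : 0 < a) (hb : 0 < b) (f : ℝ → ℝ) :
    ∫ x, f x ∂ProbabilityTheory.paretoMeasure b a =
      ∫ x in Set.Ioi b, a * b ^ a * x ^ (-(a + 1)) * f x := by
  have hmeas : Measurable (ProbabilityTheory.paretoPDF b a) :=
    (ProbabilityTheory.measurable_paretoPDFReal b a).ennreal_ofReal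
  rw [ProbabilityTheory.paretoMeasure, integral_withDensity_eq_integral_toReal_smul hmeas
    (.of_forall fun x ↦ ENNReal.ofReal_lt_top), ← integral_Ici_eq_integral_Ioi,
    ← integral_indicator measurableSet_Ici]
  refine integral_congr_ae (.of_forall fun x ↦ ?_)
  by_cases hx : b ≤ x
  · have : 0 < x := hb.trans_le hx
    simp only [Set.indicator_of_mem (Set.mem_Ici.2 hx), ProbabilityTheory.paretoPDF_of_le hx,
      smul_eq_mul]
    rw [ENNReal.toReal_ofReal (by positivity)]
  · simp [Set.indicator, hx, ProbabilityTheory.paretoPDF_of_lt (not_le.1 hx)]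

/-- The lower incomplete Gamma integral, rescaled to the unit interval, complements the upper one. -/
lemma integral_Ioi_rpow_mul_exp_neg {s c : ℝ} (hs : 0 < s) (hc : 0 < c) :
    ∫ u in Set.Ioi c, u ^ (s - 1) * exp (-u) =
      Gamma s - c ^ s * ∫ u in Set.Ioc (0 : ℝ) 1, u ^ (s - 1) * exp (-(c * u)) := by
  have hint : IntegrableOn (fun u : ℝ ↦ u ^ (s - 1) * exp (-u)) (Set.Ioi 0) := by
    simpa only [mul_comm] using GammaIntegral_convergent hs
  have hsplit : Gamma s = (∫ u in Set.Ioc 0 c, u ^ (s - 1) * exp (-u)) +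
      ∫ u in Set.Ioi c, u ^ (s - 1) * exp (-u) := by
    rw [← setIntegral_union Set.Ioc_disjoint_Ioi_same measurableSet_Ioi
      (hint.mono_set Set.Ioc_subset_Ioi_self) (hint.mono_set (Set.Ioi_subset_Ioi hc.le)),
      Set.Ioc_union_Ioi_eq_Ioi hc.le, Gamma_eq_integral hs]
    simp only [mul_comm]
  have hscale : ∫ u in Set.Ioc 0 c, u ^ (s - 1) * exp (-u) =
      c ^ s * ∫ u in Set.Ioc (0 : ℝ) 1, u ^ (s - 1) * exp (-(c * u)) := by
    have h := intervalIntegral.mul_integral_comp_mul_left (a := 0) (b := 1)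
      (f := fun u : ℝ ↦ u ^ (s - 1) * exp (-u)) c
    rw [mul_zero, mul_one, intervalIntegral.integral_of_le hc.le,
      intervalIntegral.integral_of_le zero_le_one] at h
    rw [← h, ← integral_const_mul, ← integral_const_mul]
    refine setIntegral_congr_fun measurableSet_Ioc fun u hu ↦ ?_
    simp only [mul_rpow hc.le hu.1.le, rpow_sub_one hc.ne']
    field_simp
  linarith

/-- **Exact form of `Q_j` for a Pareto distribution.** If `v` is Pareto with shape
`a > 1` and location `b > 0` (that is, `P(v > x) = (b/x)^a` for `x ≥ b`), then for
`p > 0` and every integer `j > a`,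
`E[(p v)^j e^{-p v}]/j! = (a b^a p^a / j!) ∫_{pb}^∞ u^{j-a-1} e^{-u} du
  = a (p b)^a Γ(j-a)/j! - (a (p b)^j / j!) ∫_0^1 u^{j-a-1} e^{-p b u} du`. -/
theorem pareto_mixed_poisson_exact
    {Ω : Type*} [MeasurableSpace Ω] (P : Measure Ω) [IsProbabilityMeasure P]
    (a b : ℝ) (ha : 1 < a) (hb : 0 < b)
    (v : Ω → ℝ) (hv : Measurable v)
    (htail : ∀ x : ℝ, b ≤ x → (P {ω | x < v ω}).toReal = (b / x) ^ a)
    (p : ℝ) (hp : 0 < p) (j : ℕ) (hj : a < j) :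
    (∫ ω, (p * v ω) ^ j * Real.exp (-(p * v ω)) ∂P) / j.factorial
        = a * b ^ a * p ^ a / j.factorial *
            ∫ u in Set.Ioi (p * b), u ^ ((j : ℝ) - a - 1) * Real.exp (-u) ∧
      (∫ ω, (p * v ω) ^ j * Real.exp (-(p * v ω)) ∂P) / j.factorial
        = a * (p * b) ^ a * Real.Gamma ((j : ℝ) - a) / j.factorial -
            a * (p * b) ^ j / j.factorial *
              ∫ u in Set.Ioc (0:ℝ) 1, u ^ ((j : ℝ) - a - 1) * Real.exp (-(p * b * u)) := by
  have ha0 : 0 < a := by linarith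
  have hpb : 0 < p * b := by positivity
  have hprob : IsProbabilityMeasure (P.map v) := Measure.isProbabilityMeasure_map hv.aemeasurable
  have hlaw : P.map v = ProbabilityTheory.paretoMeasure b a :=
    eq_paretoMeasure_of_real_Ioi ha0 hb fun x hx ↦ by
      rw [map_measureReal_apply hv measurableSet_Ioi]
      exact htail x hx
  have hmain : ∫ ω, (p * v ω) ^ j * exp (-(p * v ω)) ∂P =
      a * b ^ a * p ^ a * ∫ u in Set.Ioi (p * b), u ^ ((j : ℝ) - a - 1) * exp (-u) := by
    have hmap := integral_map (μ := P) hv.aemeasurable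
      (f := fun x : ℝ ↦ (p * x) ^ j * exp (-(p * x))) (by fun_prop)
    rw [← hmap, hlaw, integral_paretoMeasure ha0 hb, ← integral_comp_mul_left_Ioi' _ _ hp,
      smul_eq_mul, ← integral_const_mul, ← integral_const_mul]
    refine setIntegral_congr_fun measurableSet_Ioi fun x hx ↦ ?_
    have hx0 : 0 < x := hb.trans hx
    have hpx : 0 < p * x := by positivity
    have hpow : p ^ a * p * (p * x) ^ ((j : ℝ) - a - 1) = x ^ (-(a + 1)) * (p * x) ^ j := by
      rw [show (j : ℝ) - a - 1 = j + -(a + 1) by ring, rpow_add hpx, rpow_natCast,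
        mul_rpow hp.le hx0.le (z := -(a + 1)), rpow_neg hp.le, rpow_add_one hp.ne']
      field_simp
    linear_combination (-(a * b ^ a * exp (-(p * x)))) * hpow
  refine ⟨by rw [hmain]; ring, ?_⟩
  have hpow : b ^ a * p ^ a * (p * b) ^ ((j : ℝ) - a) = (p * b) ^ j := by
    rw [mul_comm (b ^ a), ← mul_rpow hp.le hb.le, ← rpow_add hpb, ← rpow_natCast]
    congr 1
    ring
  rw [hmain, integral_Ioi_rpow_mul_exp_neg (sub_pos.2 hj) hpb, mul_rpow hp.le hb.le (z := a),
    ← hpow]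
  ring
end

section
/- Tail sum of Q_ℓ for a Pareto distribution: Let v have the Pareto distribution with shape a > 1 and location b > 0, and let p > 0 satisfy p b < 1. Then for every integer j > a, | Σ_{ℓ ≥ j} Q_ℓ − (p b)^a Γ(j−a)/(j−1)! | ≤ a (p b)^j / ((j−a) · j! · (1 − p b)), where Q_ℓ = E[(p v)^ℓ e^{−p v}]/ℓ! and Γ is Euler's Gamma function. -/
open MeasureTheory Real

/-- The cumulative Erlang integral is the upper tail of the Poisson distribution. -/
lemma integral_pow_mul_exp_neg_div_factorial (n : ℕ) (x : ℝ) :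
    ∫ t in (0 : ℝ)..x, t ^ n * exp (-t) / n.factorial =
      1 - ∑ k ∈ Finset.range (n + 1), x ^ k * exp (-x) / k.factorial := by
  have hderiv : ∀ (n : ℕ) (y : ℝ), HasDerivAt
      (fun y : ℝ => 1 - ∑ k ∈ Finset.range (n + 1), y ^ k * exp (-y) / k.factorial)
      (y ^ n * exp (-y) / n.factorial) y := by
    intro n y
    have hexp : HasDerivAt (fun y : ℝ => exp (-y)) (-exp (-y)) y := by
      simpa using (hasDerivAt_neg y).exp
    induction n with
    | zero => simpa using hexp.const_sub 1
    | succ n ih =>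
      have hterm := (((hasDerivAt_pow (n + 1) y).mul hexp).div_const
        ((n + 1).factorial : ℝ))
      refine ((ih.sub hterm).congr_deriv ?_).congr_of_eventuallyEq (.of_forall fun z => ?_)
      · have : (n.factorial : ℝ) ≠ 0 := by positivity
        simp only [Nat.factorial_succ, Nat.add_sub_cancel]
        push_cast
        field_simp
        ring
      · simp only [Finset.sum_range_succ _ (n + 1), Pi.sub_apply, Pi.mul_apply]
        ring
  rw [intervalIntegral.integral_eq_sub_of_hasDerivAt (fun y _ => hderiv n y)
    (Continuous.intervalIntegrable (by fun_prop) _ _)]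
  simp [Finset.sum_range_succ']

lemma hasSum_poisson_tail (n : ℕ) (x : ℝ) :
    HasSum (fun ℓ : ℕ => if n + 1 ≤ ℓ then x ^ ℓ * exp (-x) / ℓ.factorial else 0)
      (∫ t in (0 : ℝ)..x, t ^ n * exp (-t) / n.factorial) := by
  have htotal : HasSum (fun ℓ : ℕ => x ^ ℓ * exp (-x) / ℓ.factorial) 1 := by
    have h := (NormedSpace.expSeries_div_hasSum_exp x).mul_right (exp (-x))
    rw [← Real.exp_eq_exp_ℝ, ← Real.exp_add, add_neg_cancel, Real.exp_zero] at h
    simpa only [div_mul_eq_mul_div] using h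
  have hhead := hasSum_sum_of_ne_finset_zero (L := .unconditional ℕ)
    (s := Finset.range (n + 1)) (f := fun ℓ : ℕ => if ℓ < n + 1 then x ^ ℓ * exp (-x) / ℓ.factorial else 0)
    (fun ℓ hℓ => if_neg (by simpa using hℓ))
  rw [Finset.sum_congr rfl fun ℓ hℓ => if_pos (Finset.mem_range.1 hℓ)] at hhead
  rw [integral_pow_mul_exp_neg_div_factorial]
  refine (htotal.sub hhead).congr_fun ?_
  intro ℓ
  by_cases h : n + 1 ≤ ℓ
  · simp [h, not_lt.2 h]
  · simp [h, not_le.1 h]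

lemma integrableOn_pow_mul_exp_neg_div_factorial (n : ℕ) :
    IntegrableOn (fun t : ℝ => t ^ n * exp (-t) / n.factorial) (Set.Ioi 0) := by
  have h := (Real.GammaIntegral_convergent (s := (n : ℝ) + 1) (by positivity)).div_const
    (n.factorial : ℝ)
  refine h.congr (.of_forall fun t => ?_)
  simp [mul_comm]

/-- Layer cake formula for the expected Poisson upper tail with a random rate. -/
lemma tsum_integral_poisson_tail_eq {Ω : Type*} [MeasurableSpace Ω] (P : Measure Ω)
    [IsProbabilityMeasure P] (X : Ω → ℝ) (hX : Measurable X) (hX0 : ∀ᵐ ω ∂P, 0 ≤ X ω) (n : ℕ) :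
    (∑' ℓ : ℕ, if n + 1 ≤ ℓ then
        (∫ ω, X ω ^ ℓ * exp (-X ω) ∂P) / ℓ.factorial else 0) =
      ∫ t in Set.Ioi (0 : ℝ), P.real {ω | t < X ω} * (t ^ n * exp (-t) / n.factorial) := by
  set g : ℝ → ℝ := fun t => t ^ n * exp (-t) / n.factorial
  have hg_cont : Continuous g := by fun_prop
  have hg0 : ∀ t, 0 ≤ t → 0 ≤ g t := fun t ht => by positivity
  set G : ℝ → ℝ := fun x => ∫ t in (0 : ℝ)..x, g t
  have hG_formula : G = fun x => 1 - ∑ k ∈ Finset.range (n + 1), x ^ k * exp (-x) / k.factorial :=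
    funext (integral_pow_mul_exp_neg_div_factorial n)
  have hG_meas : Measurable G := by rw [hG_formula]; fun_prop
  have hG0 : ∀ x, 0 ≤ x → 0 ≤ G x := fun x hx =>
    intervalIntegral.integral_nonneg hx fun t ht => hg0 t ht.1
  have hG1 : ∀ x, 0 ≤ x → G x ≤ 1 := fun x hx => by
    rw [hG_formula]
    have : 0 ≤ ∑ k ∈ Finset.range (n + 1), x ^ k * exp (-x) / k.factorial := by positivity
    simpa using this
  have hGX : Integrable (fun ω => G (X ω)) P := by
    refine Integrable.of_bound (hG_meas.comp hX).aestronglyMeasurable 1 ?_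
    filter_upwards [hX0] with ω hω
    rw [Real.norm_of_nonneg (hG0 _ hω)]
    exact hG1 _ hω
  have hsum : HasSum (fun ℓ : ℕ => ∫ ω, (if n + 1 ≤ ℓ then
      X ω ^ ℓ * exp (-X ω) / ℓ.factorial else 0) ∂P) (∫ ω, G (X ω) ∂P) := by
    refine hasSum_integral_of_dominated_convergence
      (fun ℓ ω => if n + 1 ≤ ℓ then X ω ^ ℓ * exp (-X ω) / ℓ.factorial else 0)
      (fun ℓ => ?_) (fun ℓ => ?_) ?_ ?_ ?_
    · split_ifs <;> exact Measurable.aestronglyMeasurable (by fun_prop)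
    · filter_upwards [hX0] with ω hω
      rw [Real.norm_of_nonneg]
      split_ifs <;> positivity
    · exact .of_forall fun ω => (hasSum_poisson_tail n (X ω)).summable
    · exact hGX.congr (.of_forall fun ω => (hasSum_poisson_tail n (X ω)).tsum_eq.symm)
    · exact .of_forall fun ω => hasSum_poisson_tail n (X ω)
  have hlayer := lintegral_comp_eq_lintegral_meas_lt_mul P hX0 hX.aemeasurable
    (fun t _ => hg_cont.intervalIntegrable 0 t)
    ((ae_restrict_iff' measurableSet_Ioi).2 (.of_forall fun t ht => hg0 t (le_of_lt ht)))
  calc _ = ∫ ω, G (X ω) ∂P := by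
        rw [← hsum.tsum_eq]
        refine tsum_congr fun ℓ => ?_
        split_ifs <;> simp [integral_div]
    _ = _ := by
        rw [integral_eq_lintegral_of_nonneg_ae (hX0.mono fun ω hω => hG0 _ hω)
          hGX.aestronglyMeasurable, hlayer, integral_eq_lintegral_of_nonneg_ae]
        · congr 1
          refine setLIntegral_congr_fun measurableSet_Ioi fun t ht => ?_
          rw [ENNReal.ofReal_mul measureReal_nonneg, ofReal_measureReal]
        · refine (ae_restrict_iff' measurableSet_Ioi).2 (.of_forall fun t ht => ?_)
          exact mul_nonneg measureReal_nonneg (hg0 t (le_of_lt ht))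
        · refine Measurable.aestronglyMeasurable (Measurable.mul ?_ hg_cont.measurable)
          have hanti : Antitone fun t : ℝ => P.real {ω | t < X ω} := fun s t hst =>
            measureReal_mono fun ω hω => lt_of_le_of_lt hst hω
          exact hanti.measurable

/-- **Tail sum of `Q_ℓ` for a Pareto distribution.** If `v` is Pareto with shape `a > 1`
and location `b > 0`, and `p b < 1`, then for every integer `j > a`,
`|Σ_{ℓ ≥ j} Q_ℓ - (p b)^a Γ(j-a)/(j-1)!| ≤ a (p b)^j / ((j-a) j! (1 - p b))`, where
`Q_ℓ = E[(p v)^ℓ e^{-p v}]/ℓ!`. -/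
theorem pareto_tail_sum_bound
    {Ω : Type*} [MeasurableSpace Ω] (P : Measure Ω) [IsProbabilityMeasure P]
    (a b : ℝ) (ha : 1 < a) (hb : 0 < b)
    (v : Ω → ℝ) (hv : Measurable v)
    (htail : ∀ x : ℝ, b ≤ x → (P {ω | x < v ω}).toReal = (b / x) ^ a)
    (p : ℝ) (hp : 0 < p) (hpb : p * b < 1)
    (j : ℕ) (hj : a < j) :
    |(∑' ℓ : ℕ, if j ≤ ℓ then
          (∫ ω, (p * v ω) ^ ℓ * Real.exp (-(p * v ω)) ∂P) / ℓ.factorial else 0) -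
        (p * b) ^ a * Real.Gamma ((j : ℝ) - a) / (j - 1).factorial|
      ≤ a * (p * b) ^ j / (((j : ℝ) - a) * j.factorial * (1 - p * b)) := by
  obtain ⟨n, rfl⟩ : ∃ n, j = n + 1 := ⟨j - 1, by
    have : (1 : ℝ) < j := ha.trans hj
    have : 1 < j := by exact_mod_cast this
    omega⟩
  have hnonneg : ∀ᵐ ω ∂P, 0 ≤ p * v ω := by
    have h1 : P.real {ω | b < v ω} = 1 := by
      simpa [Measure.real, div_self hb.ne'] using htail b le_rfl
    have h2 : ∀ᵐ ω ∂P, b < v ω := by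
      have : MeasurableSet {ω | b < v ω} := measurableSet_lt measurable_const hv
      rw [ae_iff_measure_eq this.nullMeasurableSet, measure_univ]
      simpa [Measure.real, ENNReal.toReal_eq_one_iff] using h1
    filter_upwards [h2] with ω hω
    exact mul_nonneg hp.le (hb.le.trans hω.le)
  have hsurv_ge : ∀ t, p * b ≤ t → P.real {ω | t < p * v ω} = (p * b / t) ^ a := by
    intro t ht
    have h := htail (t / p) (by rwa [le_div_iff₀ hp, mul_comm])
    simp only [div_lt_iff₀ hp] at h
    simp only [mul_comm p (v _)]
    rw [Measure.real, h]
    congr 1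
    field_simp
  have hsurv_lt : ∀ t, t < p * b → P.real {ω | t < p * v ω} = 1 := by
    intro t ht
    refine le_antisymm measureReal_le_one ?_
    have hc := hsurv_ge (p * b) le_rfl
    rw [div_self (by positivity), Real.one_rpow] at hc
    rw [← hc]
    exact measureReal_mono fun ω hω => ht.trans hω
  set c := p * b
  have hc : 0 < c := by positivity
  have hna : 0 < (n : ℝ) + 1 - a := by push_cast at hj; linarith
  have hΓ : IntegrableOn (fun t : ℝ => c ^ a * (exp (-t) * t ^ ((n : ℝ) + 1 - a - 1)) /
      n.factorial) (Set.Ioi 0) :=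
    ((Real.GammaIntegral_convergent hna).const_mul _).div_const _
  have hS : IntegrableOn (fun t : ℝ => P.real {ω | t < p * v ω} *
      (t ^ n * exp (-t) / n.factorial)) (Set.Ioi 0) := by
    have hanti : Antitone fun t : ℝ => P.real {ω | t < p * v ω} := fun s t hst =>
      measureReal_mono fun ω hω => lt_of_le_of_lt hst hω
    refine (integrableOn_pow_mul_exp_neg_div_factorial n).bdd_mul (c := 1)
      hanti.measurable.aestronglyMeasurable (.of_forall fun t => ?_)
    rw [Real.norm_of_nonneg measureReal_nonneg]
    exact measureReal_le_one
  have hmain : c ^ a * Gamma (((n + 1 : ℕ) : ℝ) - a) / (n + 1 - 1).factorial =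
      ∫ t in Set.Ioi (0 : ℝ), c ^ a * (exp (-t) * t ^ ((n : ℝ) + 1 - a - 1)) / n.factorial := by
    rw [integral_div, integral_const_mul, Nat.add_sub_cancel, Nat.cast_add_one,
      Real.Gamma_eq_integral hna]
  rw [tsum_integral_poisson_tail_eq P (fun ω => p * v ω) (hv.const_mul p) hnonneg n, hmain,
    ← integral_sub hS hΓ, ← Real.norm_eq_abs]
  set h : ℝ → ℝ := fun t => (c ^ a * t ^ ((n : ℝ) - a) - t ^ (n : ℝ)) / n.factorial with h_def
  have hint1 : IntervalIntegrable (fun t : ℝ => c ^ a * t ^ ((n : ℝ) - a)) volume 0 c :=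
    (intervalIntegral.intervalIntegrable_rpow' (by linarith)).const_mul _
  have hint2 : IntervalIntegrable (fun t : ℝ => t ^ (n : ℝ)) volume 0 c :=
    intervalIntegral.intervalIntegrable_rpow' (by linarith [n.cast_nonneg (α := ℝ)])
  have hh : IntegrableOn h (Set.Ioc 0 c) :=
    (intervalIntegrable_iff_integrableOn_Ioc_of_le hc.le).1 ((hint1.sub hint2).div_const _)
  have hbound := norm_integral_le_of_norm_le
    (f := fun t => P.real {ω | t < p * v ω} * (t ^ n * exp (-t) / n.factorial) -
      c ^ a * (exp (-t) * t ^ ((n : ℝ) + 1 - a - 1)) / n.factorial)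
    (μ := volume.restrict (Set.Ioi 0)) (hh.integrable_indicator measurableSet_Ioc).restrict
    ((ae_restrict_iff' measurableSet_Ioi).2 (.of_forall fun t ht => by
      have ht : 0 < t := ht
      have hexp : exp (-t) ≤ 1 := Real.exp_le_one_iff.2 (by linarith)
      have hsplit : t ^ ((n : ℝ) - a) = t ^ n / t ^ a := by
        rw [Real.rpow_sub ht, Real.rpow_natCast]
      have hta : 0 < t ^ a := by positivity
      have hexponent : (n : ℝ) + 1 - a - 1 = n - a := by ring
      rw [hexponent]
      have hge : c ≤ t → P.real {ω | t < p * v ω} * (t ^ n * exp (-t) / n.factorial) -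
          c ^ a * (exp (-t) * t ^ ((n : ℝ) - a)) / n.factorial = 0 := fun hct => by
        rw [hsurv_ge t hct, Real.div_rpow hc.le ht.le, hsplit]
        ring
      rcases le_or_gt c t with hct | htc
      · rw [hge hct, norm_zero]
        refine Set.indicator_nonneg (fun s hs => ?_) t
        have hs0 : 0 < s := hs.1
        have hsc : s ^ a ≤ c ^ a := Real.rpow_le_rpow hs0.le hs.2 (by linarith)
        have : s ^ (n : ℝ) = s ^ a * s ^ ((n : ℝ) - a) := by
          rw [← Real.rpow_add hs0]; ring_nf
        refine div_nonneg (sub_nonneg.2 ?_) (by positivity)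
        rw [this]
        gcongr
      · rw [Set.indicator_of_mem (show t ∈ Set.Ioc 0 c from ⟨ht, htc.le⟩), hsurv_lt t htc, h_def]
        have htac : t ^ a ≤ c ^ a := Real.rpow_le_rpow ht.le htc.le (by linarith)
        have hpow : t ^ n = t ^ a * t ^ ((n : ℝ) - a) := by
          rw [hsplit]; field_simp
        have hdiff : 0 ≤ c ^ a * t ^ ((n : ℝ) - a) - t ^ n := by
          rw [sub_nonneg, hpow]
          gcongr
        rw [show 1 * (t ^ n * exp (-t) / n.factorial) -
            c ^ a * (exp (-t) * t ^ ((n : ℝ) - a)) / n.factorial =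
            -((c ^ a * t ^ ((n : ℝ) - a) - t ^ n) / n.factorial * exp (-t)) by ring, norm_neg,
          Real.norm_of_nonneg (by positivity)]
        simp only [Real.rpow_natCast]
        exact mul_le_of_le_one_right (by positivity) hexp))
  refine hbound.trans ?_
  have hvalue : ∫ t in Set.Ioi (0 : ℝ), (Set.Ioc 0 c).indicator h t =
      a * c ^ (n + 1) / (((n : ℝ) + 1 - a) * (n + 1).factorial) := by
    rw [setIntegral_indicator measurableSet_Ioc,
      Set.inter_eq_self_of_subset_right Set.Ioc_subset_Ioi_self,
      ← intervalIntegral.integral_of_le hc.le, h_def, intervalIntegral.integral_div,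
      intervalIntegral.integral_sub hint1 hint2, intervalIntegral.integral_const_mul,
      integral_rpow (.inl (by linarith)),
      integral_rpow (.inl (by linarith [n.cast_nonneg (α := ℝ)])),
      Real.zero_rpow (by linarith), Real.zero_rpow (by positivity)]
    have h1 : c ^ ((n : ℝ) + 1) = c ^ (n + 1) := by exact_mod_cast Real.rpow_natCast c (n + 1)
    have h2 : c ^ a * c ^ ((n : ℝ) - a + 1) = c ^ (n + 1) := by
      rw [← h1, ← Real.rpow_add hc]; ring_nf
    have hna' : (n : ℝ) - a + 1 ≠ 0 := by linarith
    have hfac : (n.factorial : ℝ) ≠ 0 := by positivity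
    have hn1 : (n : ℝ) + 1 ≠ 0 := by positivity
    rw [sub_zero, sub_zero, ← mul_div_assoc, h2, h1, Nat.factorial_succ,
      show (n : ℝ) + 1 - a = n - a + 1 by ring]
    push_cast
    field_simp
    ring
  rw [hvalue, Nat.cast_add_one]
  have h1c : 0 < 1 - c := by linarith
  refine div_le_div_of_nonneg_left (by positivity) (by positivity) ?_
  exact mul_le_of_le_one_right (by positivity) (by linarith)
end

section
/- Gamma tail-sum identity: For every integer j ≥ 1 and every real a with 0 < a < j, the series Σ_{n=j}^{∞} Γ(n−a)/n! converges and equals Γ(j−a)/(a · (j−1)!), where Γ is Euler's Gamma function. -/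
open Real

open Filter Topology in
/-- The ratio of Gamma functions along `n ↦ s + n`, `n ↦ t + n` vanishes in the limit if `s < t`. -/
theorem tendsto_Gamma_add_div_Gamma_add {s t : ℝ} (hs : 0 < s) (hst : s < t) :
    Tendsto (fun n : ℕ => Real.Gamma (s + n) / Real.Gamma (t + n)) atTop (𝓝 0) := by
  have ht : 0 < t := hs.trans hst
  have Gamma_add_nat (x : ℝ) (hx : 0 < x) (n : ℕ) :
      Real.Gamma (x + n) = Real.Gamma x * ∏ k ∈ Finset.range n, (x + k) := by
    induction n with
    | zero => simp
    | succ n ih =>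
      rw [Finset.prod_range_succ, ← mul_assoc, ← ih, Nat.cast_succ, ← add_assoc,
        Real.Gamma_add_one (by positivity), mul_comm]
  rw [← tendsto_add_atTop_iff_nat 1]
  have hpow : Tendsto (fun n : ℕ => (n : ℝ) ^ (-(t - s))) atTop (𝓝 0) :=
    (tendsto_rpow_neg_atTop (sub_pos.2 hst)).comp tendsto_natCast_atTop_atTop
  have hlim := (((Real.GammaSeq_tendsto_Gamma t).div (Real.GammaSeq_tendsto_Gamma s)
    (Real.Gamma_pos_of_pos hs).ne').mul hpow).const_mul (Real.Gamma s / Real.Gamma t)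
  rw [mul_zero, mul_zero] at hlim
  refine hlim.congr' ?_
  filter_upwards [eventually_gt_atTop 0] with n hn
  have hn' : (0 : ℝ) < n := by exact_mod_cast hn
  have prod_ne (x : ℝ) (hx : 0 < x) : ∏ k ∈ Finset.range (n + 1), (x + k) ≠ 0 :=
    Finset.prod_ne_zero_iff.2 fun k _ => by positivity
  have hsp := prod_ne s hs
  have htp := prod_ne t ht
  have hsΓ := (Real.Gamma_pos_of_pos hs).ne'
  have htΓ := (Real.Gamma_pos_of_pos ht).ne'
  have hns := (Real.rpow_pos_of_pos hn' s).ne'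
  have hnt := (Real.rpow_pos_of_pos hn' t).ne'
  have hfac : (n.factorial : ℝ) ≠ 0 := by positivity
  rw [Gamma_add_nat s hs, Gamma_add_nat t ht, neg_sub, Real.rpow_sub hn']
  simp only [Pi.div_apply, Real.GammaSeq]
  field_simp

/-- **Gamma tail-sum identity.** For every integer `j ≥ 1` and real `0 < a < j`, the
series `Σ_{n ≥ j} Γ(n - a)/n!` converges and equals `Γ(j - a)/(a (j-1)!)`. -/
theorem gamma_tail_sum_identity (j : ℕ) (hj : 1 ≤ j) (a : ℝ) (ha : 0 < a)
    (haj : a < j) :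
    HasSum (fun n : ℕ => Real.Gamma (((n + j : ℕ) : ℝ) - a) / (n + j).factorial)
      (Real.Gamma ((j : ℝ) - a) / (a * (j - 1).factorial)) := by
  obtain ⟨i, rfl⟩ := Nat.exists_eq_add_of_le' hj
  have hs : 0 < ((i + 1 : ℕ) : ℝ) - a := sub_pos.2 haj
  have hpos (n : ℕ) : 0 < ((n + (i + 1) : ℕ) : ℝ) - a := by
    push_cast at hs ⊢
    linarith [n.cast_nonneg (α := ℝ)]
  rw [hasSum_iff_tendsto_nat_of_nonneg
    fun n => div_nonneg (Real.Gamma_pos_of_pos (hpos n)).le (Nat.cast_nonneg _)]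
  set T : ℕ → ℝ := fun n => Real.Gamma (((n + (i + 1) : ℕ) : ℝ) - a) / (a * (n + i).factorial)
    with hT
  have telescope (n : ℕ) :
      Real.Gamma (((n + (i + 1) : ℕ) : ℝ) - a) / (n + (i + 1)).factorial = T n - T (n + 1) := by
    have hΓ : Real.Gamma (((n + 1 + (i + 1) : ℕ) : ℝ) - a)
        = (((n + (i + 1) : ℕ) : ℝ) - a) * Real.Gamma (((n + (i + 1) : ℕ) : ℝ) - a) := by
      rw [← Real.Gamma_add_one (hpos n).ne']
      congr 1
      push_cast
      ring
    have hfac : (n + (i + 1)).factorial = (n + i + 1) * (n + i).factorial := Nat.factorial_succ _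
    have hfac' : n + 1 + i = n + (i + 1) := by ring
    have : (n : ℝ) + i + 1 ≠ 0 := by positivity
    simp only [hT]
    rw [hΓ, hfac', hfac]
    push_cast
    field_simp
    ring
  have hlim : Filter.Tendsto T Filter.atTop (nhds 0) := by
    have h := (tendsto_Gamma_add_div_Gamma_add hs (sub_lt_self _ ha)).div_const a
    rw [zero_div] at h
    refine h.congr fun n => ?_
    have hΓ : Real.Gamma (((i + 1 : ℕ) : ℝ) + n) = (n + i).factorial := by
      rw [← Real.Gamma_nat_eq_factorial]
      congr 1
      push_cast
      ring
    have harg : ((i + 1 : ℕ) : ℝ) - a + n = ((n + (i + 1) : ℕ) : ℝ) - a := by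
      push_cast
      ring
    rw [hΓ, harg, div_div, mul_comm _ a]
  simp_rw [telescope, Finset.sum_range_sub']
  simpa [hT] using hlim.const_sub (T 0)
end

section
/- Series expansion of the mixed Poisson probabilities for a Weibull distribution with skew parameter less than 1: Let v have the Weibull distribution with skew parameter β ∈ (0,1) and scale parameter η > 0, i.e. P(v > x) = exp(−(x/η)^β) for x ≥ 0, and let p > 0. Then for every integer j ≥ 1 the series below converges absolutely and E[(p v)^j e^{−p v}] = β Σ_{n=0}^{∞} (−1)^n Γ((n+1)β + j) / ( n! (p η)^{(n+1)β} ), where Γ is Euler's Gamma function. -/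
open MeasureTheory Real

open Filter Topology

/-- The density of the Weibull distribution on the positive half-line. -/
noncomputable def weibullDensity (β η x : ℝ) : ℝ :=
  β / η * (x / η) ^ (β - 1) * Real.exp (-(x / η) ^ β)

lemma measurable_weibullDensity (β η : ℝ) : Measurable (weibullDensity β η) := by
  unfold weibullDensity
  fun_prop

lemma weibullDensity_nonneg {β η x : ℝ} (hβ : 0 < β) (hη : 0 < η) (hx : 0 ≤ x) :
    0 ≤ weibullDensity β η x := by
  unfold weibullDensity
  positivity

lemma hasDerivAt_neg_exp_neg_div_rpow {β η x : ℝ} (hη : 0 < η) (hx : 0 < x) :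
    HasDerivAt (fun y : ℝ => -Real.exp (-(y / η) ^ β)) (weibullDensity β η x) x := by
  have h : HasDerivAt (fun y : ℝ => y / η) (1 / η) x := (hasDerivAt_id x).div_const η
  refine (h.rpow_const (p := β) (Or.inl (by positivity))).neg.exp.neg.congr_deriv ?_
  simp only [weibullDensity, Pi.neg_apply]
  ring

lemma tendsto_neg_exp_neg_div_rpow {β η : ℝ} (hβ : 0 < β) (hη : 0 < η) :
    Tendsto (fun y : ℝ => -Real.exp (-(y / η) ^ β)) atTop (𝓝 0) := by
  have h : Tendsto (fun y : ℝ => (y / η) ^ β) atTop atTop :=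
    (tendsto_rpow_atTop hβ).comp (tendsto_id.atTop_div_const hη)
  simpa using (Real.tendsto_exp_neg_atTop_nhds_zero.comp h).neg

lemma continuous_neg_exp_neg_div_rpow {β η : ℝ} (hβ : 0 < β) :
    Continuous (fun y : ℝ => -Real.exp (-(y / η) ^ β)) := by
  have h : Continuous fun y : ℝ => (y / η) ^ β :=
    (continuous_id.div_const η).rpow_const fun _ => Or.inr hβ.le
  exact (Real.continuous_exp.comp h.neg).neg

/-- The Weibull measure with skew parameter `β` and scale parameter `η`. -/
noncomputable def weibullMeasure (β η : ℝ) : Measure ℝ :=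
  (volume.restrict (Set.Ioi 0)).withDensity fun x => ENNReal.ofReal (weibullDensity β η x)

lemma weibullMeasure_Ioi {β η a : ℝ} (hβ : 0 < β) (hη : 0 < η) (ha : 0 ≤ a) :
    weibullMeasure β η (Set.Ioi a) = ENNReal.ofReal (Real.exp (-(a / η) ^ β)) := by
  have hcont : ContinuousWithinAt (fun y : ℝ => -Real.exp (-(y / η) ^ β)) (Set.Ici a) a :=
    (continuous_neg_exp_neg_div_rpow hβ).continuousWithinAt
  have hderiv : ∀ x ∈ Set.Ioi a, HasDerivAt (fun y : ℝ => -Real.exp (-(y / η) ^ β))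
      (weibullDensity β η x) x := fun x hx =>
    hasDerivAt_neg_exp_neg_div_rpow hη (ha.trans_lt hx)
  have hnonneg : ∀ x ∈ Set.Ioi a, 0 ≤ weibullDensity β η x := fun x hx =>
    weibullDensity_nonneg hβ hη (ha.trans (le_of_lt hx))
  have hlim := tendsto_neg_exp_neg_div_rpow hβ hη
  rw [weibullMeasure, withDensity_apply _ measurableSet_Ioi,
    Measure.restrict_restrict measurableSet_Ioi,
    Set.inter_eq_left.mpr (Set.Ioi_subset_Ioi ha), ← ofReal_integral_eq_lintegral_ofReal
      (integrableOn_Ioi_deriv_of_nonneg hcont hderiv hnonneg hlim)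
      ((ae_restrict_iff' measurableSet_Ioi).mpr (ae_of_all _ hnonneg)),
    integral_Ioi_of_hasDerivAt_of_nonneg hcont hderiv hnonneg hlim]
  simp

lemma weibullMeasure_Iic_zero (β η : ℝ) : weibullMeasure β η (Set.Iic 0) = 0 := by
  rw [weibullMeasure, withDensity_apply _ measurableSet_Iic,
    Measure.restrict_restrict measurableSet_Iic, Set.Iic_inter_Ioi, Set.Ioc_self]
  simp

lemma isProbabilityMeasure_weibullMeasure {β η : ℝ} (hβ : 0 < β) (hη : 0 < η) :
    IsProbabilityMeasure (weibullMeasure β η) := by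
  refine ⟨?_⟩
  rw [← Set.Iic_union_Ioi (a := (0 : ℝ)),
    measure_union (Set.Iic_disjoint_Ioi le_rfl) measurableSet_Ioi, weibullMeasure_Iic_zero,
    weibullMeasure_Ioi hβ hη le_rfl]
  simp [Real.zero_rpow hβ.ne']

/-- A probability measure with the Weibull tails is the Weibull measure. -/
lemma eq_weibullMeasure_of_Ioi {β η : ℝ} (hβ : 0 < β) (hη : 0 < η) (μ : Measure ℝ)
    [IsProbabilityMeasure μ]
    (h : ∀ x : ℝ, 0 ≤ x → μ (Set.Ioi x) = ENNReal.ofReal (Real.exp (-(x / η) ^ β))) :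
    μ = weibullMeasure β η := by
  have := isProbabilityMeasure_weibullMeasure hβ hη
  have key : ∀ a : ℝ, 0 ≤ a → μ (Set.Iic a) = weibullMeasure β η (Set.Iic a) := by
    intro a ha
    rw [← Set.compl_Ioi, prob_compl_eq_one_sub measurableSet_Ioi,
      prob_compl_eq_one_sub measurableSet_Ioi, h a ha, weibullMeasure_Ioi hβ hη ha]
  refine Measure.ext_of_Iic _ _ fun a => ?_
  rcases le_total 0 a with ha | ha
  · exact key a ha
  · have h0 := weibullMeasure_Iic_zero β η
    rw [measure_mono_null (Set.Iic_subset_Iic.mpr ha) h0,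
      measure_mono_null (Set.Iic_subset_Iic.mpr ha) ((key 0 le_rfl).trans h0)]

lemma integral_weibullMeasure {β η : ℝ} (hβ : 0 < β) (hη : 0 < η) (g : ℝ → ℝ) :
    ∫ x, g x ∂weibullMeasure β η = ∫ x in Set.Ioi 0, weibullDensity β η x * g x := by
  rw [weibullMeasure, integral_withDensity_eq_integral_toReal_smul
    (measurable_weibullDensity β η).ennreal_ofReal (ae_of_all _ fun _ => ENNReal.ofReal_lt_top)]
  refine setIntegral_congr_fun measurableSet_Ioi fun x hx => ?_
  simp only [smul_eq_mul]
  rw [ENNReal.toReal_ofReal (weibullDensity_nonneg hβ hη (le_of_lt hx))]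

lemma Gamma_add_le_mul_rpow {x β : ℝ} (hx : 0 < x) (hβ : β ∈ Set.Ioo (0 : ℝ) 1) :
    Real.Gamma (x + β) ≤ Real.Gamma x * x ^ β := by
  have hG := Real.Gamma_pos_of_pos hx
  have h := Real.Gamma_mul_add_mul_le_rpow_Gamma_mul_rpow_Gamma hx (by linarith : 0 < x + 1)
    (sub_pos.mpr hβ.2) hβ.1 (by ring)
  rw [Real.Gamma_add_one hx.ne', Real.mul_rpow hx.le hG.le] at h
  calc Real.Gamma (x + β) = Real.Gamma ((1 - β) * x + β * (x + 1)) := by ring_nf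
    _ ≤ _ := h
    _ = Real.Gamma x ^ (1 - β) * Real.Gamma x ^ β * x ^ β := by ring
    _ = Real.Gamma x * x ^ β := by rw [← Real.rpow_add hG]; simp

lemma summable_Gamma_div_factorial_mul_rpow {β c s : ℝ} (hβ : β ∈ Set.Ioo (0 : ℝ) 1)
    (hc : 0 < c) (hs : 0 ≤ s) :
    Summable fun n : ℕ => Real.Gamma (((n : ℝ) + 1) * β + s) /
      (n.factorial * c ^ (((n : ℝ) + 1) * β)) := by
  have hb := hβ.1
  have hpos : ∀ n : ℕ, 0 < Real.Gamma (((n : ℝ) + 1) * β + s) /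
      (n.factorial * c ^ (((n : ℝ) + 1) * β)) := fun n => by
    have := Real.Gamma_pos_of_pos (by positivity : 0 < ((n : ℝ) + 1) * β + s)
    positivity
  have hlim : Tendsto (fun n : ℕ => ((β + s) / c) ^ β * ((n : ℝ) + 1) ^ (-(1 - β)))
      atTop (𝓝 0) := by
    have h := (tendsto_rpow_neg_atTop (sub_pos.mpr hβ.2)).comp
      (tendsto_atTop_add_const_right atTop (1 : ℝ) (tendsto_natCast_atTop_atTop (R := ℝ)))
    simpa using h.const_mul (((β + s) / c) ^ β)
  refine summable_of_ratio_test_tendsto_lt_one zero_lt_one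
    (Eventually.of_forall fun n => (hpos n).ne') ?_
  refine squeeze_zero (fun n => by positivity) (fun n => ?_) hlim
  rw [Real.norm_of_nonneg (hpos _).le, Real.norm_of_nonneg (hpos _).le, div_le_iff₀ (hpos n)]
  have hn : (0 : ℝ) < (n : ℝ) + 1 := by positivity
  have hx : 0 < ((n : ℝ) + 1) * β + s := by positivity
  have hG := Real.Gamma_pos_of_pos hx
  have hle : ((n : ℝ) + 1) * β + s ≤ ((n : ℝ) + 1) * (β + s) := by
    nlinarith [mul_nonneg (Nat.cast_nonneg (α := ℝ) n) hs]
  have hΓ : Real.Gamma ((((n + 1 : ℕ) : ℝ) + 1) * β + s) ≤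
      Real.Gamma (((n : ℝ) + 1) * β + s) * (((n : ℝ) + 1) ^ β * (β + s) ^ β) := by
    rw [← Real.mul_rpow hn.le (by positivity)]
    calc _ = Real.Gamma ((((n : ℝ) + 1) * β + s) + β) := by push_cast; ring_nf
      _ ≤ _ := Gamma_add_le_mul_rpow hx hβ
      _ ≤ _ := by gcongr
  have hcpow : c ^ ((((n + 1 : ℕ) : ℝ) + 1) * β) = c ^ (((n : ℝ) + 1) * β) * c ^ β := by
    rw [← Real.rpow_add hc]; push_cast; ring_nf
  have hnpow : ((n : ℝ) + 1) ^ (-(1 - β)) = ((n : ℝ) + 1) ^ β / ((n : ℝ) + 1) := by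
    rw [← Real.rpow_sub_one hn.ne']; ring_nf
  rw [hcpow, hnpow, Nat.factorial_succ, Real.div_rpow (by positivity) hc.le]
  push_cast at hΓ ⊢
  rw [div_le_iff₀ (by positivity)]
  refine hΓ.trans (le_of_eq ?_)
  field_simp

lemma integrableOn_rpow_mul_exp_neg_mul_Ioi {a p : ℝ} (ha : 0 < a) (hp : 0 < p) :
    IntegrableOn (fun x : ℝ => x ^ (a - 1) * Real.exp (-(p * x))) (Set.Ioi 0) := by
  refine not_imp_comm.1 integral_undef ?_
  rw [Real.integral_rpow_mul_exp_neg_mul_Ioi ha hp]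
  have := Real.Gamma_pos_of_pos ha
  positivity

/-- Termwise expansion of the exponential in the Weibull density. -/
lemma hasSum_weibullDensity_mul {β η p x : ℝ} (hη : 0 < η) (hx : 0 < x) (j : ℕ) :
    HasSum (fun n : ℕ => β * p ^ j * ((-1) ^ n / (n.factorial * η ^ (((n : ℝ) + 1) * β))) *
        (x ^ (((n : ℝ) + 1) * β + j - 1) * Real.exp (-(p * x))))
      (weibullDensity β η x * ((p * x) ^ j * Real.exp (-(p * x)))) := by
  have h := NormedSpace.expSeries_div_hasSum_exp (-(x / η) ^ β)
  rw [← Real.exp_eq_exp_ℝ] at h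
  have hlim : weibullDensity β η x * ((p * x) ^ j * Real.exp (-(p * x))) =
      β / η * (x / η) ^ (β - 1) * ((p * x) ^ j * Real.exp (-(p * x))) *
        Real.exp (-(x / η) ^ β) := by
    rw [weibullDensity]
    ring
  rw [hlim]
  refine (h.mul_left (β / η * (x / η) ^ (β - 1) * ((p * x) ^ j * Real.exp (-(p * x))))).congr_fun
    fun n => ?_
  have hxpow : x ^ (((n : ℝ) + 1) * β + j - 1) = x ^ (β - 1) * (x ^ β) ^ n * x ^ j := by
    rw [← Real.rpow_mul_natCast hx.le, ← Real.rpow_natCast x j, ← Real.rpow_add hx,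
      ← Real.rpow_add hx]
    ring_nf
  have hηpow : η ^ (((n : ℝ) + 1) * β) = η ^ (β - 1) * (η ^ β) ^ n * η := by
    rw [← Real.rpow_mul_natCast hη.le, ← Real.rpow_add hη, ← Real.rpow_add_one hη.ne']
    ring_nf
  rw [hxpow, hηpow, neg_pow ((x / η) ^ β), Real.div_rpow hx.le hη.le,
    Real.div_rpow hx.le hη.le, mul_pow, div_pow]
  field_simp

/-- **Series expansion of the mixed Poisson probabilities, Weibull case `β < 1`.**
If `v` is Weibull with skew parameter `β ∈ (0,1)` and scale `η > 0` (that is,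
`P(v > x) = exp(-(x/η)^β)` for `x ≥ 0`) and `p > 0`, then for every integer `j ≥ 1` the
series converges absolutely and
`E[(p v)^j e^{-p v}] = β Σ_{n≥0} (-1)^n Γ((n+1)β + j)/(n! (p η)^{(n+1)β})`. -/
theorem weibull_mixed_poisson_series_beta_lt_one
    {Ω : Type*} [MeasurableSpace Ω] (P : Measure Ω) [IsProbabilityMeasure P]
    (β η : ℝ) (hβ : β ∈ Set.Ioo (0:ℝ) 1) (hη : 0 < η)
    (v : Ω → ℝ) (hv : Measurable v)
    (htail : ∀ x : ℝ, 0 ≤ x → (P {ω | x < v ω}).toReal = Real.exp (-(x / η) ^ β))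
    (p : ℝ) (hp : 0 < p) (j : ℕ) (hj : 1 ≤ j) :
    Summable (fun n : ℕ =>
        |(-1 : ℝ) ^ n * Real.Gamma (((n : ℝ) + 1) * β + j) /
          (n.factorial * (p * η) ^ (((n : ℝ) + 1) * β))|) ∧
      (∫ ω, (p * v ω) ^ j * Real.exp (-(p * v ω)) ∂P)
        = β * ∑' n : ℕ, (-1 : ℝ) ^ n * Real.Gamma (((n : ℝ) + 1) * β + j) /
            (n.factorial * (p * η) ^ (((n : ℝ) + 1) * β)) := by
  have hb := hβ.1
  have hpos : ∀ n : ℕ, 0 < ((n : ℝ) + 1) * β + j := fun n => by positivity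
  have hterm : ∀ n : ℕ, |(-1 : ℝ) ^ n * Real.Gamma (((n : ℝ) + 1) * β + j) /
      (n.factorial * (p * η) ^ (((n : ℝ) + 1) * β))| = Real.Gamma (((n : ℝ) + 1) * β + j) /
      (n.factorial * (p * η) ^ (((n : ℝ) + 1) * β)) := fun n => by
    have := Real.Gamma_pos_of_pos (hpos n)
    rw [abs_div, abs_mul, abs_pow, abs_neg, abs_one, one_pow, one_mul, abs_of_pos this,
      abs_of_pos (by positivity)]
  have hsum := summable_Gamma_div_factorial_mul_rpow hβ (mul_pos hp hη) j.cast_nonneg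
  refine ⟨by simpa only [hterm] using hsum, ?_⟩
  have hlaw : P.map v = weibullMeasure β η := by
    have := Measure.isProbabilityMeasure_map (μ := P) hv.aemeasurable
    refine eq_weibullMeasure_of_Ioi hb hη _ fun x hx => ?_
    rw [Measure.map_apply hv measurableSet_Ioi, ← htail x hx,
      ENNReal.ofReal_toReal (measure_ne_top _ _)]
    rfl
  have hmap : ∫ ω, (p * v ω) ^ j * Real.exp (-(p * v ω)) ∂P =
      ∫ x, (p * x) ^ j * Real.exp (-(p * x)) ∂P.map v :=
    (integral_map hv.aemeasurable
      (f := fun x => (p * x) ^ j * Real.exp (-(p * x))) (by fun_prop)).symm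
  have hmoment : ∀ n : ℕ, ∀ c : ℝ, β * p ^ j * (c / (n.factorial * η ^ (((n : ℝ) + 1) * β))) *
      ((1 / p) ^ (((n : ℝ) + 1) * β + j) * Real.Gamma (((n : ℝ) + 1) * β + j)) =
      β * (c * Real.Gamma (((n : ℝ) + 1) * β + j) /
        (n.factorial * (p * η) ^ (((n : ℝ) + 1) * β))) := fun n c => by
    rw [Real.mul_rpow hp.le hη.le, one_div, Real.inv_rpow hp.le, Real.rpow_add hp,
      Real.rpow_natCast]
    field_simp
  rw [hmap, hlaw, integral_weibullMeasure hb hη, ← tsum_mul_left,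
    setIntegral_congr_fun measurableSet_Ioi
      fun x hx => (hasSum_weibullDensity_mul hη hx j).tsum_eq.symm,
    ← (hasSum_integral_of_summable_integral_norm
      (fun n => (integrableOn_rpow_mul_exp_neg_mul_Ioi (hpos n) hp).const_mul _) ?_).tsum_eq]
  · refine tsum_congr fun n => ?_
    rw [integral_const_mul, Real.integral_rpow_mul_exp_neg_mul_Ioi (hpos n) hp, hmoment]
  · refine (hsum.mul_left β).congr fun n => ?_
    have hnorm : ∀ x ∈ Set.Ioi (0 : ℝ),
        ‖β * p ^ j * ((-1) ^ n / (n.factorial * η ^ (((n : ℝ) + 1) * β))) *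
          (x ^ (((n : ℝ) + 1) * β + j - 1) * Real.exp (-(p * x)))‖ =
        β * p ^ j * (1 / (n.factorial * η ^ (((n : ℝ) + 1) * β))) *
          (x ^ (((n : ℝ) + 1) * β + j - 1) * Real.exp (-(p * x))) := fun x hx => by
      have hx' : (0 : ℝ) < x := hx
      rw [norm_mul, norm_mul, norm_div, norm_pow, norm_neg, norm_one, one_pow,
        Real.norm_of_nonneg (by positivity), Real.norm_of_nonneg (by positivity),
        Real.norm_of_nonneg (by positivity)]
    rw [setIntegral_congr_fun measurableSet_Ioi hnorm, integral_const_mul,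
      Real.integral_rpow_mul_exp_neg_mul_Ioi (hpos n) hp, hmoment, one_mul]
end

section
/- Series expansion of the mixed Poisson probabilities for a Weibull distribution with skew parameter greater than 1: Let v have the Weibull distribution with skew parameter β > 1 and scale parameter η > 0, i.e. P(v > x) = exp(−(x/η)^β) for x ≥ 0, and let p > 0. Then for every integer j ≥ 1 the series below converges absolutely and E[(p v)^j e^{−p v}] = (p η)^j Σ_{n=0}^{∞} (−p η)^n Γ((n+j)/β + 1) / n!, where Γ is Euler's Gamma function. -/
open MeasureTheory Real

/-- The increment of the Gamma function over a step `s ∈ (0, 1)` is at most a factor `x ^ s`. -/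
lemma Gamma_add_le_rpow_mul_Gamma {x s : ℝ} (hx : 0 < x) (hs : 0 < s) (hs1 : s < 1) :
    Gamma (x + s) ≤ x ^ s * Gamma x := by
  have h := Gamma_mul_add_mul_le_rpow_Gamma_mul_rpow_Gamma hx (by linarith : 0 < x + 1)
    (by linarith : 0 < 1 - s) hs (by ring)
  have hΓ := Gamma_pos_of_pos hx
  rw [Gamma_add_one hx.ne', mul_rpow hx.le hΓ.le, mul_left_comm, ← rpow_add hΓ] at h
  simpa [show (1 - s) * x + s * (x + 1) = x + s by ring] using h

/-- The coefficients `Γ((n + a) s + 1) / n!` define an entire power series when `0 < s < 1`. -/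
lemma summable_pow_mul_Gamma_div_factorial {a s : ℝ} (ha : 0 ≤ a) (hs : 0 < s) (hs1 : s < 1)
    (c : ℝ) :
    Summable fun n : ℕ => c ^ n * Gamma ((n + a) * s + 1) / n.factorial := by
  have hlim : Filter.Tendsto
      (fun n : ℕ => |c| * (a + 1) ^ s * ((n + 1 : ℕ) : ℝ) ^ (-(1 - s))) Filter.atTop (nhds 0) := by
    simpa using (((tendsto_rpow_neg_atTop (by linarith : 0 < 1 - s)).comp
      tendsto_natCast_atTop_atTop).comp (Filter.tendsto_add_atTop_nat 1)).const_mul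
        (|c| * (a + 1) ^ s)
  refine summable_of_ratio_norm_eventually_le (r := 1 / 2) (by norm_num) ?_
  filter_upwards [hlim.eventually_le_const (by norm_num : (0 : ℝ) < 1 / 2)] with n hn
  have hx : 0 < ((n : ℝ) + a) * s + 1 := by positivity
  have hn0 : (0 : ℝ) < (n : ℝ) + 1 := by positivity
  have hΓ := Gamma_pos_of_pos hx
  have hstep : Gamma (((n + 1 : ℕ) + a) * s + 1)
      ≤ (((n : ℝ) + a) * s + 1) ^ s * Gamma (((n : ℝ) + a) * s + 1) := by
    have h := Gamma_add_le_rpow_mul_Gamma hx hs hs1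
    rwa [show ((n : ℝ) + a) * s + 1 + s = ((n + 1 : ℕ) + a) * s + 1 by push_cast; ring] at h
  have hΓ' : 0 < Gamma (((n + 1 : ℕ) + a) * s + 1) := Gamma_pos_of_pos (by positivity)
  have hbase : (((n : ℝ) + a) * s + 1) ^ s ≤ (a + 1) ^ s * ((n : ℝ) + 1) ^ s := by
    rw [← mul_rpow (by positivity) hn0.le]
    refine rpow_le_rpow hx.le ?_ hs.le
    have h1 : ((n : ℝ) + a) * s ≤ n + a := mul_le_of_le_one_right (by positivity) hs1.le
    have h2 : 0 ≤ a * (n : ℝ) := by positivity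
    nlinarith
  have hpow : ((n + 1 : ℕ) : ℝ) ^ (-(1 - s)) = ((n : ℝ) + 1) ^ s / ((n : ℝ) + 1) := by
    rw [show -(1 - s) = s - 1 by ring, Nat.cast_succ, rpow_sub hn0, rpow_one]
  rw [hpow] at hn
  simp only [norm_div, norm_mul, norm_pow, norm_eq_abs, abs_of_pos hΓ, abs_of_pos hΓ',
    Nat.abs_cast]
  calc |c| ^ (n + 1) * Gamma (((n + 1 : ℕ) + a) * s + 1) / (n + 1).factorial
      ≤ |c| ^ (n + 1) * ((a + 1) ^ s * ((n : ℝ) + 1) ^ s * Gamma (((n : ℝ) + a) * s + 1))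
          / (n + 1).factorial := by
        gcongr
        exact hstep.trans (mul_le_mul_of_nonneg_right hbase hΓ.le)
    _ = |c| * (a + 1) ^ s * (((n : ℝ) + 1) ^ s / ((n : ℝ) + 1)) *
          (|c| ^ n * Gamma (((n : ℝ) + a) * s + 1) / n.factorial) := by
        rw [Nat.factorial_succ, pow_succ']
        push_cast
        field_simp
    _ ≤ _ := by gcongr

section Weibull

variable {Ω : Type*} [MeasurableSpace Ω] {P : Measure Ω} [IsProbabilityMeasure P] {β η : ℝ}
  {v : Ω → ℝ}

lemma ae_pos_of_weibull_tail (hβ : 0 < β) (hv : Measurable v)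
    (htail : ∀ x : ℝ, 0 ≤ x → (P {ω | x < v ω}).toReal = exp (-(x / η) ^ β)) :
    ∀ᵐ ω ∂P, 0 < v ω := by
  have h := htail 0 le_rfl
  rw [zero_div, zero_rpow hβ.ne', neg_zero, exp_zero, ENNReal.toReal_eq_one_iff] at h
  exact (prob_compl_eq_zero_iff (measurableSet_lt measurable_const hv)).2 h

/-- The moment of order `s > 0` of the Weibull distribution, as a Lebesgue integral. -/
lemma lintegral_rpow_of_weibull_tail (hβ : 0 < β) (hη : 0 < η) (hv : Measurable v)
    (htail : ∀ x : ℝ, 0 ≤ x → (P {ω | x < v ω}).toReal = exp (-(x / η) ^ β))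
    {s : ℝ} (hs : 0 < s) :
    ∫⁻ ω, ENNReal.ofReal (v ω ^ s) ∂P = ENNReal.ofReal (η ^ s * Gamma (s / β + 1)) := by
  have hpos := ae_pos_of_weibull_tail hβ hv htail
  have hb : 0 < (η ^ β)⁻¹ := by positivity
  rw [lintegral_rpow_eq_lintegral_meas_lt_mul P (hpos.mono fun _ h => h.le) hv.aemeasurable hs]
  have hcongr : ∫⁻ t in Set.Ioi 0, P {ω | t < v ω} * ENNReal.ofReal (t ^ (s - 1)) =
      ∫⁻ t in Set.Ioi (0 : ℝ), ENNReal.ofReal (t ^ (s - 1) * exp (-(η ^ β)⁻¹ * t ^ β)) := by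
    refine setLIntegral_congr_fun measurableSet_Ioi fun t ht => ?_
    have ht : 0 < t := ht
    rw [← ENNReal.ofReal_toReal (measure_ne_top P {ω | t < v ω}), htail t ht.le,
      ← ENNReal.ofReal_mul (exp_pos _).le, mul_comm (exp _), div_rpow ht.le hη.le]
    congr 4
    ring
  rw [hcongr, ← ofReal_integral_eq_lintegral_ofReal
      (integrableOn_rpow_mul_exp_neg_mul_rpow (by linarith) hβ hb)
      ((ae_restrict_mem measurableSet_Ioi).mono fun t ht => by
        have ht : 0 < t := ht
        simp only [Pi.zero_apply]
        positivity),
    ← ENNReal.ofReal_mul hs.le,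
    integral_rpow_mul_exp_neg_mul_rpow hβ (by linarith) hb, sub_add_cancel,
    Gamma_add_one (by positivity), inv_rpow (by positivity), ← rpow_mul hη.le,
    ← rpow_neg hη.le, show -(β * (-s / β)) = s by field_simp]
  congr 1
  ring

lemma integrable_pow_of_weibull_tail (hβ : 0 < β) (hη : 0 < η) (hv : Measurable v)
    (htail : ∀ x : ℝ, 0 ≤ x → (P {ω | x < v ω}).toReal = exp (-(x / η) ^ β))
    {m : ℕ} (hm : 0 < m) :
    Integrable (fun ω => v ω ^ m) P := by
  have hpos := ae_pos_of_weibull_tail hβ hv htail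
  have h := lintegral_rpow_of_weibull_tail hβ hη hv htail (Nat.cast_pos.2 hm : (0 : ℝ) < m)
  simp only [rpow_natCast] at h
  refine ⟨(hv.pow_const m).aestronglyMeasurable, ?_⟩
  rw [hasFiniteIntegral_iff_ofReal (hpos.mono fun ω h => by positivity), h]
  exact ENNReal.ofReal_lt_top

/-- The moments of the Weibull distribution. -/
lemma integral_pow_of_weibull_tail (hβ : 0 < β) (hη : 0 < η) (hv : Measurable v)
    (htail : ∀ x : ℝ, 0 ≤ x → (P {ω | x < v ω}).toReal = exp (-(x / η) ^ β))
    {m : ℕ} (hm : 0 < m) :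
    ∫ ω, v ω ^ m ∂P = η ^ m * Gamma (m / β + 1) := by
  have hpos := ae_pos_of_weibull_tail hβ hv htail
  have h := lintegral_rpow_of_weibull_tail hβ hη hv htail (Nat.cast_pos.2 hm : (0 : ℝ) < m)
  simp only [rpow_natCast] at h
  rw [integral_eq_lintegral_of_nonneg_ae
    (hpos.mono fun ω h => by simp only [Pi.zero_apply]; positivity)
    (hv.pow_const m).aestronglyMeasurable, h, ENNReal.toReal_ofReal]
  have := Gamma_pos_of_pos (by positivity : 0 < (m : ℝ) / β + 1)
  positivity

end Weibull

/-- **Series expansion of the mixed Poisson probabilities, Weibull case `β > 1`.**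
If `v` is Weibull with skew parameter `β > 1` and scale `η > 0` (that is,
`P(v > x) = exp(-(x/η)^β)` for `x ≥ 0`) and `p > 0`, then for every integer `j ≥ 1` the
series converges absolutely and
`E[(p v)^j e^{-p v}] = (p η)^j Σ_{n≥0} (-p η)^n Γ((n+j)/β + 1)/n!`. -/
theorem weibull_mixed_poisson_series_beta_gt_one
    {Ω : Type*} [MeasurableSpace Ω] (P : Measure Ω) [IsProbabilityMeasure P]
    (β η : ℝ) (hβ : 1 < β) (hη : 0 < η)
    (v : Ω → ℝ) (hv : Measurable v)
    (htail : ∀ x : ℝ, 0 ≤ x → (P {ω | x < v ω}).toReal = Real.exp (-(x / η) ^ β))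
    (p : ℝ) (hp : 0 < p) (j : ℕ) (hj : 1 ≤ j) :
    Summable (fun n : ℕ =>
        |(-(p * η)) ^ n * Real.Gamma (((n : ℝ) + j) / β + 1) / n.factorial|) ∧
      (∫ ω, (p * v ω) ^ j * Real.exp (-(p * v ω)) ∂P)
        = (p * η) ^ j *
            ∑' n : ℕ, (-(p * η)) ^ n * Real.Gamma (((n : ℝ) + j) / β + 1) /
              n.factorial := by
  have hβ0 : 0 < β := by linarith
  have hpos := ae_pos_of_weibull_tail hβ0 hv htail
  have hsum (c : ℝ) :
      Summable fun n : ℕ => c ^ n * Gamma (((n : ℝ) + j) / β + 1) / n.factorial := by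
    simpa only [div_eq_mul_inv] using summable_pow_mul_Gamma_div_factorial
      (Nat.cast_nonneg j) (inv_pos.2 hβ0) (inv_lt_one_of_one_lt₀ hβ) c
  refine ⟨(hsum _).abs, ?_⟩
  have hterm (n : ℕ) (x : ℝ) : (p * x) ^ j * ((-(p * x)) ^ n / n.factorial) =
      p ^ j * (-p) ^ n / n.factorial * x ^ (n + j) := by
    rw [← neg_mul, mul_pow, mul_pow, pow_add]
    ring
  have hmoment (n : ℕ) : ∫ ω, v ω ^ (n + j) ∂P =
      η ^ (n + j) * Gamma (((n : ℝ) + j) / β + 1) := by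
    rw [integral_pow_of_weibull_tail hβ0 hη hv htail (by omega), Nat.cast_add]
  have hnorm (n : ℕ) : ∫ ω, ‖(p * v ω) ^ j * ((-(p * v ω)) ^ n / n.factorial)‖ ∂P =
      (p * η) ^ j * ((p * η) ^ n * Gamma (((n : ℝ) + j) / β + 1) / n.factorial) := by
    have hae : (fun ω => ‖(p * v ω) ^ j * ((-(p * v ω)) ^ n / n.factorial)‖) =ᵐ[P]
        fun ω => p ^ j * p ^ n / n.factorial * v ω ^ (n + j) := by
      filter_upwards [hpos] with ω hω
      rw [hterm, norm_mul, norm_div, norm_mul, norm_pow, norm_pow, norm_pow, norm_neg,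
        norm_of_nonneg hp.le, norm_of_nonneg hω.le, norm_natCast]
    rw [integral_congr_ae hae, integral_const_mul, hmoment, mul_pow, mul_pow, pow_add]
    ring
  have key := hasSum_integral_of_summable_integral_norm (μ := P)
    (F := fun (n : ℕ) ω => (p * v ω) ^ j * ((-(p * v ω)) ^ n / n.factorial))
    (fun n => by
      simp only [hterm]
      exact (integrable_pow_of_weibull_tail hβ0 hη hv htail (by omega)).const_mul _)
    (by simpa only [hnorm] using (hsum (p * η)).mul_left ((p * η) ^ j))
  have hexp (x : ℝ) : ∑' n : ℕ, (p * x) ^ j * ((-(p * x)) ^ n / n.factorial) =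
      (p * x) ^ j * exp (-(p * x)) := by
    rw [tsum_mul_left, exp_eq_exp_ℝ, NormedSpace.exp_eq_tsum_div]
  simp only [hexp] at key
  rw [← key.tsum_eq, ← tsum_mul_left]
  refine tsum_congr fun n => ?_
  simp only [hterm]
  rw [integral_const_mul, hmoment, ← neg_mul, mul_pow, mul_pow, pow_add]
  ring
end

section
/- Tail equivalence for Weibull distributions in the uniform model: Let v have the Weibull distribution with skew parameter β ∈ (0,1/2) and scale parameter η > 0, and let p ∈ (0,1). Then lim_{j→∞} ( Σ_{ℓ ≥ j} Q_ℓ ) / exp(−(j/(p η))^β) = 1, where Q_ℓ = E[(p v)^ℓ e^{−p v}]/ℓ!. Equivalently, since P(v ≥ j/p) = exp(−(j/(p η))^β), the limiting value of E(W_j^+)/K as the number of colors K tends to infinity is asymptotically equivalent, as j → ∞, to P(v ≥ j/p). -/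
open MeasureTheory Real Filter Topology

/-- The density at `t` of the Erlang distribution with shape `n + 1` and rate `1`; as a function
of `n`, the Poisson probability of the value `n` at mean `t`. -/
noncomputable def erlangDensity (n : ℕ) (t : ℝ) : ℝ := t ^ n * exp (-t) / n.factorial

lemma continuous_erlangDensity (n : ℕ) : Continuous (erlangDensity n) := by
  unfold erlangDensity
  fun_prop

lemma erlangDensity_nonneg (n : ℕ) {t : ℝ} (ht : 0 ≤ t) : 0 ≤ erlangDensity n t := by
  unfold erlangDensity
  positivity

lemma hasSum_erlangDensity (x : ℝ) : HasSum (fun ℓ => erlangDensity ℓ x) 1 := by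
  have h := (NormedSpace.expSeries_div_hasSum_exp x).mul_right (exp (-x))
  rw [← Real.exp_eq_exp_ℝ, ← Real.exp_add, add_neg_cancel, Real.exp_zero] at h
  refine h.congr_fun ?_
  intro ℓ
  simp only [erlangDensity]
  ring

lemma hasDerivAt_one_sub_sum_erlangDensity (n : ℕ) (x : ℝ) :
    HasDerivAt (fun t => 1 - ∑ ℓ ∈ Finset.range (n + 1), erlangDensity ℓ t)
      (erlangDensity n x) x := by
  have hexp : HasDerivAt (fun t : ℝ => exp (-t)) (-exp (-x)) x := by
    simpa using (hasDerivAt_neg x).exp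
  induction n with
  | zero =>
    simp only [zero_add, Finset.sum_range_one, erlangDensity, pow_zero, one_mul,
      Nat.factorial_zero, Nat.cast_one, div_one]
    simpa using hexp.const_sub 1
  | succ n ih =>
    have h := ih.sub (((hasDerivAt_pow (n + 1) x).mul hexp).div_const ((n + 1).factorial : ℝ))
    have hf : (fun t => 1 - ∑ ℓ ∈ Finset.range (n + 1 + 1), erlangDensity ℓ t) =
        (fun t => 1 - ∑ ℓ ∈ Finset.range (n + 1), erlangDensity ℓ t) -
          (fun t => ((fun t : ℝ => t ^ (n + 1)) * fun t => exp (-t)) t / ((n + 1).factorial : ℝ)) := by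
      ext t
      rw [Finset.sum_range_succ _ (n + 1)]
      simp only [Pi.sub_apply, Pi.mul_apply, erlangDensity]
      ring
    rw [hf]
    refine h.congr_deriv ?_
    simp only [erlangDensity, Nat.factorial_succ, Nat.cast_mul, Nat.cast_add, Nat.cast_one,
      Nat.add_sub_cancel]
    field_simp
    ring

lemma integral_erlangDensity_eq (n : ℕ) (x : ℝ) :
    ∫ t in (0 : ℝ)..x, erlangDensity n t =
      1 - ∑ ℓ ∈ Finset.range (n + 1), erlangDensity ℓ x := by
  rw [intervalIntegral.integral_eq_sub_of_hasDerivAt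
    (fun t _ => hasDerivAt_one_sub_sum_erlangDensity n t)
    ((continuous_erlangDensity n).intervalIntegrable _ _)]
  simp [erlangDensity, Finset.sum_range_succ']

lemma hasSum_erlangDensity_tail (n : ℕ) (x : ℝ) :
    HasSum (fun ℓ => if n + 1 ≤ ℓ then erlangDensity ℓ x else 0)
      (∫ t in (0 : ℝ)..x, erlangDensity n t) := by
  rw [integral_erlangDensity_eq]
  have h := hasSum_sum_of_ne_finset_zero (s := Finset.range (n + 1))
    (f := fun ℓ => if n + 1 ≤ ℓ then 0 else erlangDensity ℓ x)
    (L := .unconditional ℕ) (fun ℓ hℓ => if_pos (by simpa using hℓ))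
  rw [Finset.sum_congr rfl (g := fun ℓ => erlangDensity ℓ x)
    (fun ℓ hℓ => if_neg (by simpa using hℓ))] at h
  refine ((hasSum_erlangDensity x).sub h).congr_fun fun ℓ => ?_
  split_ifs <;> simp

lemma integral_exp_mul_erlangDensity (n : ℕ) {s : ℝ} (hs : 0 ≤ s) :
    ∫ t in Set.Ioi (0 : ℝ), exp (s * ((n + 1 : ℝ) - t)) * erlangDensity n t =
      exp (s * (n + 1)) * (1 / (1 + s)) ^ (n + 1) := by
  have h := Real.integral_rpow_mul_exp_neg_mul_Ioi (a := (n : ℝ) + 1) (r := 1 + s)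
    (by positivity) (by positivity)
  rw [Real.Gamma_nat_eq_factorial, add_sub_cancel_right] at h
  have hc : ∀ t : ℝ, exp (s * ((n + 1 : ℝ) - t)) * erlangDensity n t =
      exp (s * (n + 1)) / n.factorial * (t ^ (n : ℝ) * exp (-((1 + s) * t))) := by
    intro t
    rw [erlangDensity, Real.rpow_natCast,
      show s * ((n + 1 : ℝ) - t) = s * (n + 1) + -(s * t) by ring,
      show -((1 + s) * t) = -(s * t) + -t by ring, Real.exp_add, Real.exp_add]
    ring
  simp_rw [hc]
  rw [integral_const_mul, h, ← Nat.cast_add_one, Real.rpow_natCast]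
  field_simp

lemma integrableOn_exp_mul_erlangDensity (n : ℕ) {s : ℝ} (hs : 0 ≤ s) :
    IntegrableOn (fun t => exp (s * ((n + 1 : ℝ) - t)) * erlangDensity n t) (Set.Ioi 0) := by
  refine Integrable.of_integral_ne_zero ?_
  rw [integral_exp_mul_erlangDensity n hs]
  positivity

lemma integrableOn_erlangDensity (n : ℕ) : IntegrableOn (erlangDensity n) (Set.Ioi 0) := by
  simpa using integrableOn_exp_mul_erlangDensity n le_rfl

lemma setIntegral_erlangDensity (n : ℕ) : ∫ t in Set.Ioi (0 : ℝ), erlangDensity n t = 1 := by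
  simpa using integral_exp_mul_erlangDensity n le_rfl

lemma one_le_integral_exp_mul_erlangDensity (n : ℕ) {s : ℝ} (hs : 0 ≤ s) :
    1 ≤ ∫ t in Set.Ioi (0 : ℝ), exp (s * ((n + 1 : ℝ) - t)) * erlangDensity n t := by
  rw [integral_exp_mul_erlangDensity n hs, ← Nat.cast_add_one, mul_comm s, Real.exp_nat_mul,
    ← mul_pow, mul_one_div]
  refine one_le_pow₀ ?_
  rw [one_le_div (by positivity)]
  linarith [Real.add_one_le_exp s]

lemma integral_exp_mul_erlangDensity_le (n : ℕ) {s : ℝ} (hs : 0 ≤ s) :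
    ∫ t in Set.Ioi (0 : ℝ), exp (s * ((n + 1 : ℝ) - t)) * erlangDensity n t ≤
      exp ((n + 1) * s ^ 2) := by
  rw [integral_exp_mul_erlangDensity n hs, ← Nat.cast_add_one, mul_comm s, Real.exp_nat_mul,
    Real.exp_nat_mul, ← mul_pow]
  refine pow_le_pow_left₀ (by positivity) ?_ _
  have hlog : s - s ^ 2 ≤ log (1 + s) := by
    refine le_trans ?_ (Real.one_sub_inv_le_log_of_pos (by positivity))
    rw [← sub_nonneg, show 1 - (1 + s)⁻¹ - (s - s ^ 2) = s ^ 3 / (1 + s) by field_simp; ring]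
    positivity
  rw [mul_one_div, div_le_iff₀ (by positivity)]
  calc exp s ≤ exp (s ^ 2 + log (1 + s)) := Real.exp_le_exp.2 (by linarith)
    _ = exp (s ^ 2) * (1 + s) := by rw [Real.exp_add, Real.exp_log (by positivity)]

lemma integral_abs_exp_sub_one_mul_erlangDensity_le (n : ℕ) {s : ℝ} (hs : 0 < s) :
    IntegrableOn (fun t => |exp (s * ((n + 1 : ℝ) - t)) - 1| * erlangDensity n t) (Set.Ioi 0) ∧
    ∫ t in Set.Ioi (0 : ℝ), |exp (s * ((n + 1 : ℝ) - t)) - 1| * erlangDensity n t ≤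
      √(exp ((n + 1) * (2 * s) ^ 2) - 1) := by
  set B := exp ((n + 1) * (2 * s) ^ 2) - 1
  have hB : 0 < B := sub_pos.2 (Real.one_lt_exp_iff.2 (by positivity))
  set δ := √B
  have hδ : 0 < δ := Real.sqrt_pos.2 hB
  have hδB : δ * δ = B := Real.mul_self_sqrt hB.le
  have i₁ := integrableOn_exp_mul_erlangDensity n hs.le
  have i₂ := integrableOn_exp_mul_erlangDensity n (s := 2 * s) (by positivity)
  have i₀ := integrableOn_erlangDensity n
  have hint : IntegrableOn
      (fun t => |exp (s * ((n + 1 : ℝ) - t)) - 1| * erlangDensity n t) (Set.Ioi 0) := by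
    refine IntegrableOn.congr_fun (i₁.sub i₀).norm (fun t ht => ?_) measurableSet_Ioi
    simp only [Pi.sub_apply, Real.norm_eq_abs]
    rw [← sub_one_mul, abs_mul, abs_of_nonneg (erlangDensity_nonneg n (le_of_lt ht))]
  refine ⟨hint, ?_⟩
  have hbound : ∀ t ∈ Set.Ioi (0 : ℝ),
      |exp (s * ((n + 1 : ℝ) - t)) - 1| * erlangDensity n t ≤
        (2 * δ)⁻¹ * (exp (2 * s * ((n + 1 : ℝ) - t)) * erlangDensity n t
          - 2 * (exp (s * ((n + 1 : ℝ) - t)) * erlangDensity n t) + erlangDensity n t)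
        + δ / 2 * erlangDensity n t := by
    intro t ht
    have hg := erlangDensity_nonneg n (le_of_lt ht)
    have hsq : exp (2 * s * ((n + 1 : ℝ) - t)) = exp (s * ((n + 1 : ℝ) - t)) ^ 2 := by
      rw [← Real.exp_nat_mul]
      congr 1
      push_cast
      ring
    rw [hsq]
    set u := exp (s * ((n + 1 : ℝ) - t))
    have hu : |u - 1| ≤ (2 * δ)⁻¹ * (u - 1) ^ 2 + δ / 2 := by
      rw [← sub_nonneg, ← sq_abs (u - 1),
        show (2 * δ)⁻¹ * |u - 1| ^ 2 + δ / 2 - |u - 1| = (2 * δ)⁻¹ * (|u - 1| - δ) ^ 2 by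
          field_simp
          ring]
      positivity
    calc _ ≤ _ := mul_le_mul_of_nonneg_right hu hg
      _ = _ := by ring
  have i₃ : IntegrableOn (fun t => exp (2 * s * ((n + 1 : ℝ) - t)) * erlangDensity n t
      - 2 * (exp (s * ((n + 1 : ℝ) - t)) * erlangDensity n t)) (Set.Ioi 0) :=
    i₂.sub (i₁.const_mul 2)
  have i₄ : IntegrableOn (fun t => exp (2 * s * ((n + 1 : ℝ) - t)) * erlangDensity n t
      - 2 * (exp (s * ((n + 1 : ℝ) - t)) * erlangDensity n t) + erlangDensity n t) (Set.Ioi 0) :=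
    i₃.add i₀
  have h1 := one_le_integral_exp_mul_erlangDensity n hs.le
  have h2 := integral_exp_mul_erlangDensity_le n (s := 2 * s) (by positivity)
  refine (setIntegral_mono_on hint ((i₄.const_mul (2 * δ)⁻¹).add (i₀.const_mul (δ / 2)))
    measurableSet_Ioi hbound).trans ?_
  simp only [Pi.add_apply]
  rw [integral_add (i₄.const_mul _) (i₀.const_mul _), integral_const_mul, integral_const_mul,
    integral_add i₃ i₀, integral_sub i₂ (i₁.const_mul 2),
    integral_const_mul, setIntegral_erlangDensity]
  have hV : ∀ a b : ℝ, 1 ≤ a → b ≤ B + 1 → (2 * δ)⁻¹ * (b - 2 * a + 1) + δ / 2 * 1 ≤ δ := by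
    intro a b ha hb
    have h : (2 * δ)⁻¹ * (b - 2 * a + 1) ≤ (2 * δ)⁻¹ * (δ * δ) :=
      mul_le_mul_of_nonneg_left (by linarith) (by positivity)
    have h' : (2 * δ)⁻¹ * (δ * δ) = δ / 2 := by field_simp
    linarith
  exact hV _ _ h1 (by simpa [B] using h2)

lemma abs_exp_sub_mul_rpow_sub_one_le {A s β : ℝ} (hA : 0 ≤ A) (hs : 0 ≤ s) (hβ0 : 0 ≤ β)
    (hβ : β ≤ 1) :
    |exp (A - A * s ^ β) - 1| ≤ |exp (A * (1 - s)) - 1| := by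
  rcases le_total s 1 with h | h
  · have h1 := Real.self_le_rpow_of_le_one hs h hβ
    have h2 : exp (A - A * s ^ β) ≤ exp (A * (1 - s)) := Real.exp_le_exp.2 (by nlinarith)
    have h3 : 1 ≤ exp (A - A * s ^ β) := Real.one_le_exp (by
      nlinarith [Real.rpow_le_one hs h hβ0])
    rw [abs_of_nonneg (by linarith), abs_of_nonneg (by linarith)]
    linarith
  · have h1 := Real.rpow_le_self_of_one_le h hβ
    have h2 : exp (A * (1 - s)) ≤ exp (A - A * s ^ β) := Real.exp_le_exp.2 (by nlinarith)
    have h3 : exp (A - A * s ^ β) ≤ 1 := Real.exp_le_one_iff.2 (by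
      nlinarith [Real.one_le_rpow h hβ0])
    rw [abs_of_nonpos (by linarith), abs_of_nonpos (by linarith)]
    linarith

lemma tsum_integral_erlangDensity_eq {Ω : Type*} [MeasurableSpace Ω] (P : Measure Ω)
    [IsProbabilityMeasure P] {X : Ω → ℝ} (hX : Measurable X) (hpos : ∀ᵐ ω ∂P, 0 ≤ X ω) (n : ℕ) :
    ∑' ℓ, (if n + 1 ≤ ℓ then ∫ ω, erlangDensity ℓ (X ω) ∂P else 0) =
      ∫ t in Set.Ioi (0 : ℝ), (P {ω | t < X ω}).toReal * erlangDensity n t := by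
  have hmeas : Measurable fun ω => ∫ t in (0 : ℝ)..X ω, erlangDensity n t := by
    simp_rw [integral_erlangDensity_eq]
    exact measurable_const.sub (Finset.measurable_fun_sum _ fun ℓ _ =>
      (continuous_erlangDensity ℓ).measurable.comp hX)
  have hnn : ∀ᵐ ω ∂P, 0 ≤ ∫ t in (0 : ℝ)..X ω, erlangDensity n t := by
    filter_upwards [hpos] with ω hω
    exact intervalIntegral.integral_nonneg hω fun t ht => erlangDensity_nonneg n ht.1
  have hterm : ∀ ω, HasSum (fun ℓ => if n + 1 ≤ ℓ then erlangDensity ℓ (X ω) else 0)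
      (∫ t in (0 : ℝ)..X ω, erlangDensity n t) := fun ω => hasSum_erlangDensity_tail n (X ω)
  have hsum := hasSum_integral_of_dominated_convergence (μ := P)
    (F := fun ℓ ω => if n + 1 ≤ ℓ then erlangDensity ℓ (X ω) else 0)
    (f := fun ω => ∫ t in (0 : ℝ)..X ω, erlangDensity n t)
    (fun ℓ ω => if n + 1 ≤ ℓ then erlangDensity ℓ (X ω) else 0)
    (fun ℓ => by
      split_ifs
      · exact ((continuous_erlangDensity ℓ).measurable.comp hX).aestronglyMeasurable
      · exact aestronglyMeasurable_const)
    (fun ℓ => by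
      filter_upwards [hpos] with ω hω
      split_ifs
      · rw [Real.norm_of_nonneg (erlangDensity_nonneg ℓ hω)]
      · simp)
    (ae_of_all _ fun ω => (hterm ω).summable)
    (by
      simp_rw [fun ω => (hterm ω).tsum_eq]
      refine Integrable.of_bound hmeas.aestronglyMeasurable 1 ?_
      filter_upwards [hnn, hpos] with ω hω hω'
      rw [Real.norm_of_nonneg hω, integral_erlangDensity_eq]
      linarith [Finset.sum_nonneg fun ℓ (_ : ℓ ∈ Finset.range (n + 1)) =>
        erlangDensity_nonneg ℓ hω'])
    (ae_of_all _ hterm)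
  have hite : ∀ ℓ, (if n + 1 ≤ ℓ then ∫ ω, erlangDensity ℓ (X ω) ∂P else 0) =
      ∫ ω, (if n + 1 ≤ ℓ then erlangDensity ℓ (X ω) else 0) ∂P := by
    intro ℓ
    split_ifs <;> simp
  have hanti : Antitone fun t => (P {ω | t < X ω}).toReal := fun a b hab =>
    ENNReal.toReal_mono (measure_ne_top _ _)
      (measure_mono fun ω (hω : b < X ω) => hab.trans_lt hω)
  have hnn' : ∀ᵐ t ∂volume.restrict (Set.Ioi (0 : ℝ)), 0 ≤ erlangDensity n t := by
    filter_upwards [ae_restrict_mem measurableSet_Ioi] with t ht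
    exact erlangDensity_nonneg n (le_of_lt ht)
  simp_rw [hite]
  rw [hsum.tsum_eq, integral_eq_lintegral_of_nonneg_ae hnn hmeas.aestronglyMeasurable,
    lintegral_comp_eq_lintegral_meas_lt_mul P hpos hX.aemeasurable
      (fun t _ => (continuous_erlangDensity n).intervalIntegrable _ _) hnn',
    integral_eq_lintegral_of_nonneg_ae]
  · congr 1
    refine lintegral_congr fun t => ?_
    rw [ENNReal.ofReal_mul ENNReal.toReal_nonneg, ENNReal.ofReal_toReal (measure_ne_top _ _)]
  · filter_upwards [hnn'] with t ht
    exact mul_nonneg ENNReal.toReal_nonneg ht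
  · exact (hanti.measurable.mul (continuous_erlangDensity n).measurable).aestronglyMeasurable

lemma tendsto_integral_exp_rpow_sub_mul_erlangDensity {β c : ℝ} (hβ : 0 < β) (hβ' : β < 1 / 2)
    (hc : 0 < c) :
    Tendsto (fun n : ℕ => ∫ t in Set.Ioi (0 : ℝ),
      exp ((((n : ℝ) + 1) / c) ^ β - (t / c) ^ β) * erlangDensity n t) atTop (𝓝 1) := by
  have hlim : Tendsto (fun n : ℕ => √(exp (4 * (c ^ (-β)) ^ 2 *
      ((n : ℝ) + 1) ^ (-(1 - 2 * β))) - 1)) atTop (𝓝 0) := by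
    have h := (tendsto_rpow_neg_atTop (show 0 < 1 - 2 * β by linarith)).comp
      (tendsto_atTop_add_const_right _ (1 : ℝ) tendsto_natCast_atTop_atTop)
    have h' := ((Real.continuous_exp.tendsto _).comp (h.const_mul (4 * (c ^ (-β)) ^ 2))).sub_const 1
    simpa [Function.comp_def] using (Real.continuous_sqrt.tendsto _).comp h'
  rw [tendsto_iff_norm_sub_tendsto_zero]
  refine squeeze_zero (fun _ => norm_nonneg _) (fun n => ?_) hlim
  have hj : (0 : ℝ) < (n : ℝ) + 1 := by positivity
  set j : ℝ := (n : ℝ) + 1 with hjdef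
  set A := (j / c) ^ β with hA
  have hApos : 0 < A := by positivity
  obtain ⟨hint, hle⟩ := integral_abs_exp_sub_one_mul_erlangDensity_le n (s := A / j)
    (by positivity)
  rw [← hjdef] at hint hle
  have hpt : ∀ t ∈ Set.Ioi (0 : ℝ),
      ‖exp (A - (t / c) ^ β) * erlangDensity n t - erlangDensity n t‖ ≤
        |exp (A / j * (j - t)) - 1| * erlangDensity n t := by
    intro t ht
    have ht' : 0 < t := ht
    have hg := erlangDensity_nonneg n ht'.le
    rw [← sub_one_mul, norm_mul, Real.norm_of_nonneg hg, Real.norm_eq_abs]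
    have h := abs_exp_sub_mul_rpow_sub_one_le hApos.le (div_pos ht' hj).le hβ.le
      (show β ≤ 1 by linarith)
    rw [hA, ← Real.mul_rpow (by positivity) (by positivity), ← hA,
      show j / c * (t / j) = t / c by field_simp,
      show A * (1 - t / j) = A / j * (j - t) by field_simp] at h
    exact mul_le_mul_of_nonneg_right h hg
  have hpt' := (ae_restrict_mem (μ := volume) (measurableSet_Ioi (a := (0 : ℝ)))).mono hpt
  have i₀ := integrableOn_erlangDensity n
  have hmeas : Measurable fun t : ℝ =>
      exp (A - (t / c) ^ β) * erlangDensity n t - erlangDensity n t := by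
    have := (continuous_erlangDensity n).measurable
    fun_prop
  have i₁ : IntegrableOn (fun t => exp (A - (t / c) ^ β) * erlangDensity n t) (Set.Ioi 0) := by
    have h := (hint.mono' hmeas.aestronglyMeasurable hpt').add i₀
    exact IntegrableOn.congr_fun h (fun t _ => by simp) measurableSet_Ioi
  rw [show (1 : ℝ) = ∫ t in Set.Ioi (0 : ℝ), erlangDensity n t from
    (setIntegral_erlangDensity n).symm, ← integral_sub i₁ i₀]
  refine (norm_integral_le_of_norm_le hint hpt').trans (hle.trans_eq ?_)
  rw [setIntegral_erlangDensity]
  have hexp : j * (2 * (A / j)) ^ 2 = 4 * (c ^ (-β)) ^ 2 * j ^ (-(1 - 2 * β)) := by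
    rw [hA, Real.div_rpow hj.le hc.le, Real.rpow_neg hc.le,
      show -(1 - 2 * β) = β + β - 1 by ring, Real.rpow_sub hj, Real.rpow_add hj, Real.rpow_one]
    field_simp
    ring
  rw [hexp]

/-- **Tail equivalence for Weibull distributions in the uniform model.** If `v` is
Weibull with skew parameter `β ∈ (0,1/2)` and scale `η > 0`, and `p ∈ (0,1)`, then
`Σ_{ℓ ≥ j} Q_ℓ ∼ exp(-(j/(p η))^β) = P(v ≥ j/p)` as `j → ∞`, where
`Q_ℓ = E[(p v)^ℓ e^{-p v}]/ℓ!`. -/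
theorem weibull_tail_equivalence_uniform_model
    {Ω : Type*} [MeasurableSpace Ω] (P : Measure Ω) [IsProbabilityMeasure P]
    (β η : ℝ) (hβ : β ∈ Set.Ioo (0:ℝ) (1/2)) (hη : 0 < η)
    (v : Ω → ℝ) (hv : Measurable v)
    (htail : ∀ x : ℝ, 0 ≤ x → (P {ω | x < v ω}).toReal = Real.exp (-(x / η) ^ β))
    (p : ℝ) (hp : p ∈ Set.Ioo (0:ℝ) 1) :
    Tendsto
      (fun j : ℕ =>
        (∑' ℓ : ℕ, if j ≤ ℓ then
            (∫ ω, (p * v ω) ^ ℓ * Real.exp (-(p * v ω)) ∂P) / ℓ.factorial else 0) /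
          Real.exp (-((j : ℝ) / (p * η)) ^ β))
      atTop (𝓝 1) := by
  obtain ⟨hβ0, hβ1⟩ := hβ
  have hp0 : 0 < p := hp.1
  have hpos : ∀ᵐ ω ∂P, 0 ≤ p * v ω := by
    have h := htail 0 le_rfl
    rw [zero_div, Real.zero_rpow hβ0.ne', neg_zero, Real.exp_zero, ENNReal.toReal_eq_one_iff] at h
    have h' : ∀ᵐ ω ∂P, 0 < v ω :=
      (prob_compl_eq_zero_iff (measurableSet_lt measurable_const hv)).2 h
    filter_upwards [h'] with ω hω
    positivity
  rw [← tendsto_add_atTop_iff_nat 1]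
  refine (tendsto_integral_exp_rpow_sub_mul_erlangDensity hβ0 hβ1
    (mul_pos hp0 hη)).congr fun n => ?_
  have hsum := tsum_integral_erlangDensity_eq P (hv.const_mul p) hpos n
  simp only [erlangDensity, integral_div] at hsum
  rw [hsum, ← integral_div]
  refine setIntegral_congr_fun measurableSet_Ioi fun t ht => ?_
  have ht' : 0 < t := ht
  have hset : {ω | t < p * v ω} = {ω | t / p < v ω} := by
    ext ω
    simp [div_lt_iff₀' hp0]
  simp only [erlangDensity]
  rw [hset, htail _ (by positivity), div_div, sub_eq_neg_add, Real.exp_add,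
    Real.exp_neg ((_ / _) ^ β), Real.exp_neg (((n + 1 : ℕ) / _ : ℝ) ^ β)]
  push_cast
  field_simp
end

section
/- Small-p asymptotics of the moments of the mixed Poisson tail: Let v be a nonnegative random variable, j ≥ 1 an integer, and define for p > 0 the random variable X_j(p) = Σ_{ℓ ≥ j} (p v)^ℓ e^{−p v}/ℓ! and m_j(p) = E[X_j(p)], m_{2,j}(p) = E[X_j(p)²]. Then: (i) if E(v^j) < ∞, lim_{p→0+} m_j(p)/p^j = E(v^j)/j!; (ii) if E(v^{2j}) < ∞, lim_{p→0+} m_{2,j}(p)/p^{2j} = E(v^{2j})/(j!)²; (iii) if E(v^j) < ∞, the derivative m_j′(p) equals E[ v (p v)^{j−1} e^{−p v} ]/(j−1)! and lim_{p→0+} m_j′(p)/p^{j−1} = E(v^j)/(j−1)!. -/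
open MeasureTheory Real Filter Topology

/-- The tail at level `j` of the Poisson distribution of parameter `y`, in closed form. -/
noncomputable def poissonTail (j : ℕ) (y : ℝ) : ℝ :=
  1 - ∑ l ∈ Finset.range j, y ^ l * Real.exp (-y) / l.factorial

lemma hasSum_poisson_s15 (y : ℝ) :
    HasSum (fun l : ℕ => y ^ l * Real.exp (-y) / l.factorial) 1 := by
  have h := (NormedSpace.expSeries_div_hasSum_exp y).mul_right (Real.exp (-y))
  rw [← Real.exp_eq_exp_ℝ, ← Real.exp_add, add_neg_cancel, Real.exp_zero] at h
  exact h.congr_fun (fun l => by ring)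

lemma hasSum_poissonTail (j : ℕ) (y : ℝ) :
    HasSum (fun l : ℕ => if j ≤ l then y ^ l * Real.exp (-y) / l.factorial else 0)
      (poissonTail j y) := by
  have h := (hasSum_poisson_s15 y).sub (hasSum_sum_of_ne_finset_zero
    (f := fun l : ℕ => if l < j then y ^ l * Real.exp (-y) / l.factorial else 0)
    (s := Finset.range j) (fun l hl => if_neg (by simpa using hl)))
  rw [Finset.sum_congr rfl (fun l hl => if_pos (Finset.mem_range.mp hl))] at h
  refine h.congr_fun (fun l => ?_)
  by_cases hl : j ≤ l <;> simp [hl, not_lt.mpr, not_le.mp]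

lemma poissonTail_nonneg (j : ℕ) {y : ℝ} (hy : 0 ≤ y) : 0 ≤ poissonTail j y := by
  refine (hasSum_poissonTail j y).nonneg (fun l => ?_)
  split_ifs <;> positivity

lemma poissonTail_succ (j : ℕ) (y : ℝ) :
    poissonTail (j + 1) y = poissonTail j y - y ^ j * Real.exp (-y) / j.factorial := by
  simp only [poissonTail, Finset.sum_range_succ]
  ring

lemma le_poissonTail (j : ℕ) {y : ℝ} (hy : 0 ≤ y) :
    y ^ j * Real.exp (-y) / j.factorial ≤ poissonTail j y := by
  have h := poissonTail_nonneg (j + 1) hy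
  rw [poissonTail_succ] at h
  linarith

lemma hasDerivAt_poissonTail (k : ℕ) (y : ℝ) :
    HasDerivAt (poissonTail (k + 1)) (y ^ k * Real.exp (-y) / k.factorial) y := by
  have hexp : HasDerivAt (fun y : ℝ => Real.exp (-y)) (-Real.exp (-y)) y := by
    simpa using (hasDerivAt_neg y).exp
  induction k with
  | zero =>
    have h : poissonTail (0 + 1) = fun y : ℝ => 1 - Real.exp (-y) := by
      funext y
      simp [poissonTail]
    rw [h]
    simpa using hexp.const_sub 1
  | succ k ih =>
    have h : poissonTail (k + 1 + 1) = fun y : ℝ =>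
        poissonTail (k + 1) y - y ^ (k + 1) * Real.exp (-y) / (k + 1).factorial :=
      funext (poissonTail_succ (k + 1))
    rw [h]
    refine (ih.sub (((hasDerivAt_pow (k + 1) y).mul hexp).div_const _)).congr_deriv ?_
    rw [Nat.factorial_succ]
    push_cast
    have := Nat.factorial_ne_zero k
    field_simp
    simp

lemma continuous_poissonTail (j : ℕ) : Continuous (poissonTail j) := by
  unfold poissonTail
  fun_prop

lemma poissonTail_le (j : ℕ) {y : ℝ} (hy : 0 ≤ y) :
    poissonTail j y ≤ y ^ j / j.factorial := by
  cases j with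
  | zero => simp [poissonTail]
  | succ k =>
    have hd (x : ℝ) : HasDerivAt (fun x : ℝ => x ^ (k + 1) / (k + 1).factorial -
        poissonTail (k + 1) x)
        (x ^ k / k.factorial - x ^ k * Real.exp (-x) / k.factorial) x := by
      refine (((hasDerivAt_pow (k + 1) x).div_const _).sub
        (hasDerivAt_poissonTail k x)).congr_deriv ?_
      rw [Nat.factorial_succ]
      push_cast
      have := Nat.factorial_ne_zero k
      field_simp
    have hmono : MonotoneOn (fun x : ℝ => x ^ (k + 1) / (k + 1).factorial -
        poissonTail (k + 1) x) (Set.Ici 0) := by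
      refine monotoneOn_of_deriv_nonneg (convex_Ici 0)
        (fun x _ => (hd x).continuousAt.continuousWithinAt)
        (fun x _ => (hd x).differentiableAt.differentiableWithinAt) (fun x hx => ?_)
      rw [interior_Ici] at hx
      have hx : 0 < x := hx
      rw [(hd x).deriv, sub_nonneg]
      gcongr
      exact mul_le_of_le_one_right (by positivity) (Real.exp_le_one_iff.mpr (by linarith))
    have h := hmono Set.self_mem_Ici hy hy
    have h0 : poissonTail (k + 1) 0 = 0 := by
      simp [poissonTail, Finset.sum_range_succ']
    simp only [h0] at h
    simpa using h

/-- The normalized tail `p ↦ poissonTail j (p a) / p ^ j` is at most its limit as `p → 0⁺`. -/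
lemma poissonTail_mul_div_pow_le (j : ℕ) {a p : ℝ} (ha : 0 ≤ a) (hp : 0 < p) :
    poissonTail j (p * a) / p ^ j ≤ a ^ j / j.factorial := by
  rw [div_le_iff₀ (by positivity)]
  calc poissonTail j (p * a) ≤ (p * a) ^ j / j.factorial := poissonTail_le j (by positivity)
    _ = a ^ j / j.factorial * p ^ j := by ring

lemma tendsto_exp_neg_mul_nhdsGT_zero (a : ℝ) :
    Tendsto (fun p : ℝ => Real.exp (-(p * a))) (𝓝[>] 0) (𝓝 1) := by
  have h : Continuous fun p : ℝ => Real.exp (-(p * a)) := by fun_prop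
  simpa using (h.tendsto 0).mono_left nhdsWithin_le_nhds

lemma tendsto_poissonTail_mul_div_pow (j : ℕ) {a : ℝ} (ha : 0 ≤ a) :
    Tendsto (fun p : ℝ => poissonTail j (p * a) / p ^ j) (𝓝[>] 0)
      (𝓝 (a ^ j / j.factorial)) := by
  have hlow := (tendsto_exp_neg_mul_nhdsGT_zero a).const_mul (a ^ j / j.factorial)
  rw [mul_one] at hlow
  refine tendsto_of_tendsto_of_tendsto_of_le_of_le' hlow tendsto_const_nhds ?_ ?_
  · filter_upwards [self_mem_nhdsWithin] with p hp
    have hp : 0 < p := hp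
    rw [le_div_iff₀ (by positivity)]
    calc a ^ j / j.factorial * Real.exp (-(p * a)) * p ^ j
        = (p * a) ^ j * Real.exp (-(p * a)) / j.factorial := by ring
      _ ≤ poissonTail j (p * a) := le_poissonTail j (by positivity)
  · filter_upwards [self_mem_nhdsWithin] with p hp
    exact poissonTail_mul_div_pow_le j ha hp

section Moments

variable {Ω : Type*} [MeasurableSpace Ω] {P : Measure Ω} {v : Ω → ℝ}

lemma aestronglyMeasurable_poissonTail (hv : Measurable v) (j : ℕ) (p : ℝ) :
    AEStronglyMeasurable (fun ω => poissonTail j (p * v ω)) P :=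
  ((continuous_poissonTail j).measurable.comp (hv.const_mul p)).aestronglyMeasurable

/-- Small-`p` asymptotics of all moments of the mixed Poisson tail. -/
lemma tendsto_integral_poissonTail_pow (hv : Measurable v) (hv0 : ∀ ω, 0 ≤ v ω) (j r : ℕ)
    (hint : Integrable (fun ω => v ω ^ (r * j)) P) :
    Tendsto (fun p : ℝ => (∫ ω, poissonTail j (p * v ω) ^ r ∂P) / p ^ (r * j)) (𝓝[>] 0)
      (𝓝 ((∫ ω, v ω ^ (r * j) ∂P) / (j.factorial : ℝ) ^ r)) := by
  have hpow (x y : ℝ) : (x / y ^ j) ^ r = x ^ r / y ^ (r * j) := by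
    rw [div_pow, ← pow_mul, mul_comm]
  have hlim (ω : Ω) : (v ω ^ j / j.factorial) ^ r = v ω ^ (r * j) / (j.factorial : ℝ) ^ r := by
    rw [div_pow, ← pow_mul, mul_comm]
  simp only [← integral_div, ← hpow, ← hlim]
  refine tendsto_integral_filter_of_dominated_convergence
    (fun ω => (v ω ^ j / j.factorial) ^ r) ?_ ?_ ?_ ?_
  · exact .of_forall fun p => by
      simp only [div_eq_mul_inv]
      exact ((aestronglyMeasurable_poissonTail hv j p).mul_const _).pow r
  · filter_upwards [self_mem_nhdsWithin] with p hp
    refine .of_forall fun ω => ?_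
    have hp : 0 < p := hp
    have h0 : 0 ≤ poissonTail j (p * v ω) := poissonTail_nonneg j (mul_nonneg hp.le (hv0 ω))
    rw [Real.norm_of_nonneg (by positivity)]
    exact pow_le_pow_left₀ (by positivity) (poissonTail_mul_div_pow_le j (hv0 ω) hp) r
  · simpa only [hlim] using hint.div_const _
  · exact .of_forall fun ω => (tendsto_poissonTail_mul_div_pow j (hv0 ω)).pow r

lemma hasDerivAt_integral_poissonTail [IsFiniteMeasure P] (hv : Measurable v)
    (hv0 : ∀ ω, 0 ≤ v ω) (k : ℕ) (hint : Integrable (fun ω => v ω ^ (k + 1)) P)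
    {p : ℝ} (hp : 0 < p) :
    HasDerivAt (fun q => ∫ ω, poissonTail (k + 1) (q * v ω) ∂P)
      ((∫ ω, v ω * (p * v ω) ^ k * Real.exp (-(p * v ω)) ∂P) / k.factorial) p := by
  rw [← integral_div]
  refine (hasDerivAt_integral_of_dominated_loc_of_deriv_le
    (Ioo_mem_nhds hp (by linarith : p < 2 * p))
    (bound := fun ω => v ω ^ (k + 1) * (2 * p) ^ k / k.factorial)
    (F' := fun q ω => v ω * (q * v ω) ^ k * Real.exp (-(q * v ω)) / k.factorial)
    (.of_forall (aestronglyMeasurable_poissonTail hv (k + 1))) ?_ ?_ ?_ ?_ ?_).2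
  · refine (hint.mul_const (p ^ (k + 1) / (k + 1).factorial)).mono'
      (aestronglyMeasurable_poissonTail hv (k + 1) p) (.of_forall fun ω => ?_)
    have hpv : 0 ≤ p * v ω := mul_nonneg hp.le (hv0 ω)
    rw [Real.norm_of_nonneg (poissonTail_nonneg _ hpv)]
    exact (poissonTail_le _ hpv).trans_eq (by ring)
  · exact Measurable.aestronglyMeasurable (by fun_prop)
  · refine .of_forall fun ω q hq => ?_
    have hq0 : 0 < q := hq.1
    have hvω := hv0 ω
    rw [Real.norm_of_nonneg (by positivity)]
    refine div_le_div_of_nonneg_right ?_ (Nat.cast_nonneg _)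
    calc v ω * (q * v ω) ^ k * Real.exp (-(q * v ω)) ≤ v ω * (q * v ω) ^ k :=
          mul_le_of_le_one_right (by positivity)
            (Real.exp_le_one_iff.mpr (neg_nonpos.mpr (by positivity)))
      _ = v ω ^ (k + 1) * q ^ k := by ring
      _ ≤ v ω ^ (k + 1) * (2 * p) ^ k := by
          gcongr
          exact hq.2.le
  · exact (hint.mul_const _).div_const _
  · refine .of_forall fun ω q _ => ?_
    refine ((hasDerivAt_poissonTail k (q * v ω)).comp q
      (hasDerivAt_mul_const (v ω))).congr_deriv ?_
    ring

lemma tendsto_integral_poisson_div_pow (hv : Measurable v) (hv0 : ∀ ω, 0 ≤ v ω) (k : ℕ)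
    (hint : Integrable (fun ω => v ω ^ (k + 1)) P) :
    Tendsto (fun p : ℝ => (∫ ω, v ω * (p * v ω) ^ k * Real.exp (-(p * v ω)) ∂P) /
      k.factorial / p ^ k) (𝓝[>] 0) (𝓝 ((∫ ω, v ω ^ (k + 1) ∂P) / k.factorial)) := by
  have hlim : Tendsto (fun p : ℝ => ∫ ω, v ω ^ (k + 1) * Real.exp (-(p * v ω)) ∂P) (𝓝[>] 0)
      (𝓝 (∫ ω, v ω ^ (k + 1) ∂P)) := by
    refine tendsto_integral_filter_of_dominated_convergence (fun ω => v ω ^ (k + 1)) ?_ ?_ hint ?_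
    · exact .of_forall fun p => Measurable.aestronglyMeasurable (by fun_prop)
    · filter_upwards [self_mem_nhdsWithin] with p hp
      refine .of_forall fun ω => ?_
      have hvω := hv0 ω
      rw [Real.norm_of_nonneg (by positivity)]
      exact mul_le_of_le_one_right (by positivity)
        (Real.exp_le_one_iff.mpr (neg_nonpos.mpr (mul_nonneg (le_of_lt hp) hvω)))
    · refine .of_forall fun ω => ?_
      simpa using (tendsto_exp_neg_mul_nhdsGT_zero (v ω)).const_mul (v ω ^ (k + 1))
  refine (hlim.div_const (k.factorial : ℝ)).congr' ?_
  filter_upwards [self_mem_nhdsWithin] with p hp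
  have hp : 0 < p := hp
  rw [div_right_comm, ← integral_div (p ^ k)]
  congr 1
  refine integral_congr_ae (.of_forall fun ω => ?_)
  field_simp
  ring

end Moments

/-- **Small-`p` asymptotics of the moments of the mixed Poisson tail.** For a
nonnegative random variable `v` and `j ≥ 1`, with
`X_j(p) = Σ_{ℓ ≥ j} (p v)^ℓ e^{-p v}/ℓ!`, `m_j(p) = E[X_j(p)]` and
`m_{2,j}(p) = E[X_j(p)²]`:
(i) if `E(v^j) < ∞` then `m_j(p)/p^j → E(v^j)/j!` as `p → 0⁺`;
(ii) if `E(v^{2j}) < ∞` then `m_{2,j}(p)/p^{2j} → E(v^{2j})/(j!)²`;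
(iii) if `E(v^j) < ∞` then `m_j'(p) = E[v (p v)^{j-1} e^{-p v}]/(j-1)!` and
`m_j'(p)/p^{j-1} → E(v^j)/(j-1)!`. -/
theorem mixed_poisson_tail_moment_asymptotics
    {Ω : Type*} [MeasurableSpace Ω] (P : Measure Ω) [IsProbabilityMeasure P]
    (v : Ω → ℝ) (hv : Measurable v) (hvnonneg : ∀ ω, 0 ≤ v ω)
    (j : ℕ) (hj : 1 ≤ j)
    (X : ℝ → Ω → ℝ)
    (hX : ∀ p ω, X p ω =
      ∑' ℓ : ℕ, if j ≤ ℓ then (p * v ω) ^ ℓ * Real.exp (-(p * v ω)) / ℓ.factorial else 0)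
    (m m2 : ℝ → ℝ)
    (hm : ∀ p, m p = ∫ ω, X p ω ∂P)
    (hm2 : ∀ p, m2 p = ∫ ω, (X p ω) ^ 2 ∂P) :
    (Integrable (fun ω => v ω ^ j) P →
        Tendsto (fun p : ℝ => m p / p ^ j) (𝓝[>] 0)
          (𝓝 ((∫ ω, v ω ^ j ∂P) / j.factorial))) ∧
      (Integrable (fun ω => v ω ^ (2 * j)) P →
        Tendsto (fun p : ℝ => m2 p / p ^ (2 * j)) (𝓝[>] 0)
          (𝓝 ((∫ ω, v ω ^ (2 * j) ∂P) / (j.factorial : ℝ) ^ 2))) ∧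
      (Integrable (fun ω => v ω ^ j) P →
        (∀ p : ℝ, 0 < p →
          HasDerivAt m
            ((∫ ω, v ω * (p * v ω) ^ (j - 1) * Real.exp (-(p * v ω)) ∂P) /
              (j - 1).factorial) p) ∧
        Tendsto
          (fun p : ℝ =>
            (∫ ω, v ω * (p * v ω) ^ (j - 1) * Real.exp (-(p * v ω)) ∂P) /
              (j - 1).factorial / p ^ (j - 1))
          (𝓝[>] 0) (𝓝 ((∫ ω, v ω ^ j ∂P) / (j - 1).factorial))) := by
  obtain rfl : X = fun p ω => poissonTail j (p * v ω) := by
    funext p ω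
    rw [hX, (hasSum_poissonTail j (p * v ω)).tsum_eq]
  obtain rfl : m = _ := funext hm
  obtain rfl : m2 = _ := funext hm2
  refine ⟨fun hint => ?_, tendsto_integral_poissonTail_pow hv hvnonneg j 2, fun hint => ?_⟩
  · simpa using tendsto_integral_poissonTail_pow hv hvnonneg j 1 (by simpa using hint)
  · obtain ⟨k, rfl⟩ := Nat.exists_eq_add_of_le' hj
    exact ⟨fun p hp => hasDerivAt_integral_poissonTail hv hvnonneg k hint hp,
      tendsto_integral_poisson_div_pow hv hvnonneg k hint⟩
end
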